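/- Let d be a positive integer and u₀ ∈ 𝒱(d). Then the solution t ↦ u(t) ∈ 𝒱(d) of the cubic Szegő equation with u(0) = u₀ is quasiperiodic: there exist a positive integer n, real numbers ω₁, …, ω_n, and a smooth mapping Φ : 𝕋ⁿ → 𝒱(d) such that u(t) = Φ(ω₁t, …, ω_n t) for every t ∈ ℝ. -/

import Mathlib

open scoped BigOperators ComplexConjugate

noncomputable section

/-- The Hardy space `L²₊(𝕋)` of the circle, modeled by the Hilbert space `ℓ²(ℕ, ℂ)` of
sequences of nonnegative Fourier (= Taylor) coefficients. -/
abbrev Hardy : Type := lp (fun _ : ℕ => ℂ) 2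

/-- The Fourier coefficients of an element of the Hardy space. -/
def coeffs (f : Hardy) : ℕ → ℂ := fun n => f n

/-- Membership in the Sobolev space `Hˢ₊(𝕋)`, expressed on Fourier coefficients. -/
def InHs (s : ℝ) (u : ℕ → ℂ) : Prop :=
  Summable fun k : ℕ => ((1 : ℝ) + (k : ℝ) ^ 2) ^ s * ‖u k‖ ^ 2

/-- The `Hˢ` norm, expressed on Fourier coefficients. -/
def hsNorm (s : ℝ) (u : ℕ → ℂ) : ℝ :=
  Real.sqrt (∑' k : ℕ, ((1 : ℝ) + (k : ℝ) ^ 2) ^ s * ‖u k‖ ^ 2)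

/-- Membership in the Wiener algebra `W`. -/
def InW (u : ℕ → ℂ) : Prop := Summable fun k : ℕ => ‖u k‖

/-- The Wiener norm `‖u‖_W = Σ |û(k)|`. -/
def wienerNorm (u : ℕ → ℂ) : ℝ := ∑' k : ℕ, ‖u k‖

/-- The `L²` norm, expressed on Fourier coefficients. -/
def l2Norm (u : ℕ → ℂ) : ℝ := Real.sqrt (∑' k : ℕ, ‖u k‖ ^ 2)

/-- The Hankel operator `H_u(h) = Π(u h̄)`, expressed on Fourier coefficients:
`(H_u h)^(n) = Σ_p û(n+p) conj(ĥ(p))`. -/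
def hankel (u h : ℕ → ℂ) : ℕ → ℂ := fun n => ∑' p : ℕ, u (n + p) * conj (h p)

/-- The shifted Hankel operator `K_u = S* H_u`. -/
def shiftedHankel (u h : ℕ → ℂ) : ℕ → ℂ := fun n => hankel u h (n + 1)

/-- Fourier coefficients of the pointwise product `fg` of two holomorphic (Hardy class)
functions: the Cauchy product. -/
def mulCoeff (f g : ℕ → ℂ) : ℕ → ℂ := fun n => ∑ p ∈ Finset.range (n + 1), f p * g (n - p)

/-- Fourier coefficients of `T_{a b̄}(h) = Π(a b̄ h)` for `a, b, h` in the Hardy class. -/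
def toeplitzAB (a b h : ℕ → ℂ) : ℕ → ℂ :=
  fun n => ∑' q : ℕ, conj (b q) * mulCoeff a h (n + q)

/-- Fourier coefficients of `T_{ā}(h) = Π(ā h)` for `a, h` in the Hardy class. -/
def toeplitzConj (a h : ℕ → ℂ) : ℕ → ℂ := fun n => ∑' q : ℕ, conj (a q) * h (n + q)

/-- The Szegő nonlinearity `Π(|u|²u) = T_{u ū}(u)`. -/
def szegoNL (u : ℕ → ℂ) : ℕ → ℂ := toeplitzAB u u u

/-- The operator `B_u = (i/2) H_u² - i T_{|u|²}` of the Lax pair. -/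
def laxB (u h : ℕ → ℂ) : ℕ → ℂ := fun n =>
  Complex.I / 2 * hankel u (hankel u h) n - Complex.I * toeplitzAB u u h n

/-- The operator `C_u = (i/2) K_u² - i T_{|u|²}` of the Lax pair. -/
def laxC (u h : ℕ → ℂ) : ℕ → ℂ := fun n =>
  Complex.I / 2 * shiftedHankel u (shiftedHankel u h) n - Complex.I * toeplitzAB u u h n

/-- `u : ℝ → L²₊` is a (smooth in time, `Hˢ`-valued) solution of the cubic Szegő equation
`i ∂_t u = Π(|u|²u)`. -/
def IsSzegoSolution (s : ℝ) (u : ℝ → Hardy) : Prop :=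
  (∀ t, InHs s (coeffs (u t))) ∧ ContDiff ℝ (⊤ : ℕ∞) u ∧
    ∀ t n, HasDerivAt (fun τ : ℝ => coeffs (u τ) n) (-Complex.I * szegoNL (coeffs (u t)) n) t

/-- The Hankel operator with symbol `u` (composed with complex conjugation, which does not
change its range), as a linear map on finitely supported sequences. -/
def hankelLM (u : ℕ → ℂ) : (ℕ →₀ ℂ) →ₗ[ℂ] (ℕ → ℂ) :=
  Finsupp.lsum ℂ fun p => LinearMap.toSpanSingleton ℂ (ℕ → ℂ) fun n => u (n + p)

/-- The rank of the Hankel operator `H_u`. -/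
def hankelRank (u : ℕ → ℂ) : ℕ := Module.finrank ℂ (LinearMap.range (hankelLM u))

/-- The finite rank manifold `𝒱(d)`: `u` with `rk H_u = [(d+1)/2]` and `rk K_u = [d/2]`
(recall `K_u = H_{S*u}`). -/
def InV (d : ℕ) (u : ℕ → ℂ) : Prop :=
  InHs (1 / 2) u ∧ FiniteDimensional ℂ (LinearMap.range (hankelLM u)) ∧
    hankelRank u = (d + 1) / 2 ∧ hankelRank (fun n => u (n + 1)) = d / 2

/-- `w = w^y = (I + y H_u²)⁻¹(1)`, characterized by `(I + y H_u²) w = 1`. -/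
def IsResolventOne (y : ℝ) (u w : ℕ → ℂ) : Prop :=
  Memℓp w 2 ∧ ∀ n, w n + (y : ℂ) * hankel u (hankel u w) n = if n = 0 then 1 else 0

/-- The Hamiltonian vector field `X_{J^y}(u) = 2iy w^y H_u(w^y)` (a pointwise product of two
Hardy class functions), expressed on Fourier coefficients; `w` stands for `w^y`. -/
def XJ (y : ℝ) (u w : ℕ → ℂ) : ℕ → ℂ :=
  fun n => 2 * Complex.I * (y : ℂ) * mulCoeff w (hankel u w) n

/-- The operator `G_u^y(h) = -y w^y Π(conj(w^y) h) + y² (H_u w^y) Π(conj(H_u w^y) h)`;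
`w` stands for `w^y`. -/
def Gop (y : ℝ) (u w h : ℕ → ℂ) : ℕ → ℂ := fun n =>
  -(y : ℂ) * mulCoeff w (toeplitzConj w h) n
    + (y : ℂ) ^ 2 * mulCoeff (hankel u w) (toeplitzConj (hankel u w) h) n

/-- The operator `F_u^y(h) = G_u^y(h) - y² (h | H_u w^y) H_u w^y`; `w` stands for `w^y`. -/
def Fop (y : ℝ) (u w h : ℕ → ℂ) : ℕ → ℂ := fun n =>
  Gop y u w h n - (y : ℂ) ^ 2 * (∑' p : ℕ, h p * conj (hankel u w p)) * hankel u w n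

open scoped InnerProductSpace

/-- The Wiener algebra, modeled by absolutely summable sequences of coefficients. -/
abbrev Wiener : Type := lp (fun _ : ℕ => ℂ) 1

/-- The right shift of a sequence. -/
def shiftSeq (h : ℕ → ℂ) : ℕ → ℂ
  | 0 => 0
  | n + 1 => h n

lemma hasSum_shiftSeq {p : ENNReal} (hp : 0 < p.toReal) (f : lp (fun _ : ℕ => ℂ) p) :
    HasSum (fun n => ‖shiftSeq f n‖ ^ p.toReal) (‖f‖ ^ p.toReal) := by
  have h := lp.hasSum_norm hp f
  rw [← hasSum_nat_add_iff' 1]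
  simpa [shiftSeq, Real.zero_rpow hp.ne'] using h

/-- The right shift on `ℓᵖ`, as a linear isometry. -/
def shift (p : ENNReal) [Fact (1 ≤ p)] (hp : 0 < p.toReal) :
    lp (fun _ : ℕ => ℂ) p →ₗᵢ[ℂ] lp (fun _ : ℕ => ℂ) p where
  toFun f := ⟨shiftSeq f, memℓp_gen (hasSum_shiftSeq hp f).summable⟩
  map_add' f g := by
    ext n
    cases n with
    | zero => exact (add_zero (0 : ℂ)).symm
    | succ n => rfl
  map_smul' c f := by
    ext n
    cases n <;> simp [shiftSeq]
  norm_map' f := by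
    have h1 := hasSum_shiftSeq hp f
    have h2 := lp.hasSum_norm hp
      (⟨shiftSeq f, memℓp_gen (hasSum_shiftSeq hp f).summable⟩ : lp (fun _ : ℕ => ℂ) p)
    exact Real.rpow_left_injOn hp.ne' (norm_nonneg _) (norm_nonneg _) (h2.unique h1)

/-- The right shift on the Hardy space. -/
def hardyShift : Hardy →L[ℂ] Hardy := (shift 2 (by norm_num)).toContinuousLinearMap

/-- The right shift on the Wiener algebra. -/
def wienerShift : Wiener →L[ℂ] Wiener := (shift 1 (by norm_num)).toContinuousLinearMap

@[simp] lemma hardyShift_zero (f : Hardy) : hardyShift f 0 = 0 := rfl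

@[simp] lemma hardyShift_succ (f : Hardy) (n : ℕ) : hardyShift f (n + 1) = f n := rfl

@[simp] lemma norm_hardyShift (f : Hardy) : ‖hardyShift f‖ = ‖f‖ :=
  (shift 2 (by norm_num)).norm_map f

@[simp] lemma norm_wienerShift (f : Wiener) : ‖wienerShift f‖ = ‖f‖ :=
  (shift 1 (by norm_num)).norm_map f

lemma norm_hardyShift_pow_apply (n : ℕ) (f : Hardy) : ‖(hardyShift ^ n) f‖ = ‖f‖ := by
  induction n with
  | zero => simp
  | succ n ih => rw [pow_succ', mul_apply_eq_comp, norm_hardyShift, ih]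

lemma norm_hardyShift_pow_le (n : ℕ) : ‖hardyShift ^ n‖ ≤ 1 :=
  ContinuousLinearMap.opNorm_le_bound _ zero_le_one fun f => by
    rw [norm_hardyShift_pow_apply, one_mul]

lemma norm_wienerShift_pow_apply (n : ℕ) (f : Wiener) : ‖(wienerShift ^ n) f‖ = ‖f‖ := by
  induction n with
  | zero => simp
  | succ n ih => rw [pow_succ', mul_apply_eq_comp, norm_wienerShift, ih]

lemma norm_wienerShift_pow_le (n : ℕ) : ‖wienerShift ^ n‖ ≤ 1 :=
  ContinuousLinearMap.opNorm_le_bound _ zero_le_one fun f => by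
    rw [norm_wienerShift_pow_apply, one_mul]

lemma hardyShift_pow_apply_of_lt (f : Hardy) {n k : ℕ} (h : k < n) :
    (hardyShift ^ n) f k = 0 := by
  induction n generalizing k with
  | zero => omega
  | succ n ih =>
    rw [pow_succ', mul_apply_eq_comp]
    cases k with
    | zero => simp
    | succ k => simpa using ih (by omega)

lemma hardyShift_pow_apply_add (f : Hardy) (n k : ℕ) :
    (hardyShift ^ n) f (n + k) = f k := by
  induction n with
  | zero => simp
  | succ n ih =>
    rw [pow_succ', mul_apply_eq_comp, show n + 1 + k = n + k + 1 by ring]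
    simpa using ih

lemma Wiener.hasSum_norm (a : Wiener) : HasSum (fun n => ‖a n‖) ‖a‖ := by
  simpa using lp.hasSum_norm (p := 1) (by norm_num) a

lemma Wiener.summable_smul_shift (a : Wiener) : Summable fun n => a n • hardyShift ^ n := by
  refine .of_norm_bounded a.hasSum_norm.summable fun n => ?_
  rw [norm_smul]
  exact mul_le_of_le_one_right (norm_nonneg _) (norm_hardyShift_pow_le n)

/-- Multiplication by an element of the Wiener algebra, acting on the Hardy space. -/
def mulOp : Wiener →L[ℂ] Hardy →L[ℂ] Hardy :=
  LinearMap.mkContinuous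
    { toFun := fun a => ∑' n, a n • hardyShift ^ n
      map_add' := fun a b => by
        rw [← a.summable_smul_shift.tsum_add b.summable_smul_shift]
        exact tsum_congr fun n => by simp [add_smul]
      map_smul' := fun c a => by
        rw [RingHom.id_apply, ← a.summable_smul_shift.tsum_const_smul]
        exact tsum_congr fun n => by simp [mul_smul] } 1 fun a => by
    rw [one_mul]
    refine tsum_of_norm_bounded a.hasSum_norm fun n => ?_
    rw [norm_smul]
    exact mul_le_of_le_one_right (norm_nonneg _) (norm_hardyShift_pow_le n)

lemma hasSum_mulOp (a : Wiener) : HasSum (fun n => a n • hardyShift ^ n) (mulOp a) :=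
  a.summable_smul_shift.hasSum

lemma hasSum_mulOp_apply (a : Wiener) (h : Hardy) :
    HasSum (fun n => a n • (hardyShift ^ n) h) (mulOp a h) :=
  (hasSum_mulOp a).mapL (ContinuousLinearMap.apply ℂ Hardy h)

lemma norm_mulOp_le (a : Wiener) : ‖mulOp a‖ ≤ ‖a‖ :=
  tsum_of_norm_bounded a.hasSum_norm fun n => by
    rw [norm_smul]
    exact mul_le_of_le_one_right (norm_nonneg _) (norm_hardyShift_pow_le n)

lemma norm_mulOp_apply_le (a : Wiener) (h : Hardy) : ‖mulOp a h‖ ≤ ‖a‖ * ‖h‖ :=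
  ((mulOp a).le_opNorm h).trans
    (mul_le_mul_of_nonneg_right (norm_mulOp_le a) (norm_nonneg _))

/-- Evaluation of a coefficient on the Hardy space. -/
def coeffCLM (n : ℕ) : Hardy →L[ℂ] ℂ := lp.evalCLM ℂ (fun _ : ℕ => ℂ) 2 n

@[simp] lemma coeffCLM_apply (n : ℕ) (f : Hardy) : coeffCLM n f = f n := rfl

lemma mulOp_coeff (a : Wiener) (h : Hardy) (n : ℕ) :
    mulOp a h n = mulCoeff a h n := by
  have h1 : HasSum (fun k => a k * (hardyShift ^ k) h n) (mulOp a h n) := by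
    simpa using (hasSum_mulOp_apply a h).mapL (coeffCLM n)
  rw [h1.unique (hasSum_sum_of_ne_finset_zero (s := Finset.range (n + 1)) fun k hk => by
    rw [hardyShift_pow_apply_of_lt h (by simpa using hk), mul_zero]), mulCoeff]
  refine Finset.sum_congr rfl fun k hk => ?_
  obtain ⟨j, rfl⟩ := Nat.exists_eq_add_of_le (Nat.lt_succ_iff.1 (Finset.mem_range.1 hk))
  rw [hardyShift_pow_apply_add, Nat.add_sub_cancel_left]

/-- The canonical basis vectors of the Hardy space. -/
def hardyBasis (n : ℕ) : Hardy := lp.single 2 n (1 : ℂ)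

@[simp] lemma inner_hardyBasis_left (n : ℕ) (f : Hardy) : ⟪hardyBasis n, f⟫_ℂ = f n := by
  simp [hardyBasis, lp.inner_single_left]

lemma hardyBasis_apply (n k : ℕ) : hardyBasis n k = if k = n then 1 else 0 := by
  simp [hardyBasis, Pi.single_apply]

lemma hardyShift_hardyBasis (n : ℕ) : hardyShift (hardyBasis n) = hardyBasis (n + 1) := by
  ext k
  cases k <;> simp [hardyBasis_apply]

lemma hardyShift_pow_hardyBasis (q n : ℕ) :
    (hardyShift ^ q) (hardyBasis n) = hardyBasis (n + q) := by
  induction q with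
  | zero => simp
  | succ q ih => rw [pow_succ', mul_apply_eq_comp, ih, hardyShift_hardyBasis, add_assoc]

lemma adjoint_hardyShift_apply (f : Hardy) (n : ℕ) :
    hardyShift.adjoint f n = f (n + 1) := by
  rw [← inner_hardyBasis_left, ContinuousLinearMap.adjoint_inner_right, hardyShift_hardyBasis,
    inner_hardyBasis_left]

lemma adjoint_mulOp_coeff (a : Wiener) (h : Hardy) (n : ℕ) :
    HasSum (fun q => conj (a q) * h (n + q)) ((mulOp a).adjoint h n) := by
  rw [← inner_hardyBasis_left, ContinuousLinearMap.adjoint_inner_right]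
  have h1 := ((hasSum_mulOp_apply a (hardyBasis n)).mapL (innerSL ℂ h)).star
  simp only [map_smul, innerSL_apply_apply, smul_eq_mul, star_mul', hardyShift_pow_hardyBasis,
    RCLike.star_def, inner_conj_symm, inner_hardyBasis_left] at h1
  exact h1

/-- The inclusion of the Wiener algebra in the Hardy space. -/
def toHardy : Wiener →L[ℂ] Hardy :=
  (ContinuousLinearMap.apply ℂ Hardy (hardyBasis 0)).comp mulOp

lemma toHardy_eq (a : Wiener) : toHardy a = mulOp a (hardyBasis 0) := rfl

@[simp] lemma toHardy_apply (a : Wiener) (n : ℕ) : toHardy a n = a n := by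
  rw [toHardy_eq, mulOp_coeff, mulCoeff, Finset.sum_eq_single n]
  · simp [hardyBasis_apply]
  · intro k hk hkn
    rw [hardyBasis_apply, if_neg, mul_zero]
    simp only [Finset.mem_range] at hk
    omega
  · simp

lemma coe_toHardy (a : Wiener) : (toHardy a : ℕ → ℂ) = a := funext (toHardy_apply a)

lemma mulCoeff_comm (f g : ℕ → ℂ) : mulCoeff f g = mulCoeff g f := by
  funext n
  rw [mulCoeff, mulCoeff, ← Finset.sum_range_reflect]
  refine Finset.sum_congr rfl fun k hk => ?_
  have : k ≤ n := Nat.lt_succ_iff.1 (Finset.mem_range.1 hk)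
  rw [mul_comm, show n + 1 - 1 - k = n - k by omega, show n - (n - k) = k by omega]

lemma mulOp_toHardy_comm (a b : Wiener) : mulOp a (toHardy b) = mulOp b (toHardy a) := by
  ext n
  rw [mulOp_coeff, mulOp_coeff, coe_toHardy, coe_toHardy, mulCoeff_comm]

lemma norm_sq_apply_le (c : Wiener) (m : ℕ) : ‖mulOp c (toHardy c) m‖ ≤ ‖toHardy c‖ ^ 2 := by
  rw [mulOp_coeff, coe_toHardy, mulCoeff]
  have h1 : ∑ p ∈ Finset.range (m + 1), ‖c p‖ ^ 2 ≤ ‖toHardy c‖ ^ 2 := by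
    simpa using lp.sum_rpow_le_norm_rpow (p := 2) (by norm_num) (toHardy c)
      (Finset.range (m + 1))
  have h2 : ∑ p ∈ Finset.range (m + 1), ‖c (m - p)‖ ^ 2 ≤ ‖toHardy c‖ ^ 2 := by
    rw [← Finset.sum_range_reflect]
    refine le_of_eq_of_le (Finset.sum_congr rfl fun k hk => ?_) h1
    have : k ≤ m := Nat.lt_succ_iff.1 (Finset.mem_range.1 hk)
    rw [show m - (m + 1 - 1 - k) = k by omega]
  calc ‖∑ p ∈ Finset.range (m + 1), c p * c (m - p)‖
      ≤ ∑ p ∈ Finset.range (m + 1), (‖c p‖ ^ 2 + ‖c (m - p)‖ ^ 2) / 2 := by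
        refine norm_sum_le_of_le _ fun p _ => ?_
        rw [norm_mul]
        nlinarith [sq_nonneg (‖c p‖ - ‖c (m - p)‖)]
    _ ≤ _ := by
        rw [← Finset.sum_div, Finset.sum_add_distrib]
        linarith

lemma norm_inner_mulOp_sq_le (a b c : Wiener) :
    ‖⟪mulOp a (toHardy b), mulOp c (toHardy c)⟫_ℂ‖ ≤ ‖a‖ * ‖b‖ * ‖toHardy c‖ ^ 2 := by
  have hb (n : ℕ) : ‖⟪(hardyShift ^ n) (toHardy b), mulOp c (toHardy c)⟫_ℂ‖ ≤
      ‖b‖ * ‖toHardy c‖ ^ 2 := by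
    have h1 := ((hasSum_mulOp_apply b (hardyBasis 0)).mapL (hardyShift ^ n)).mapL
      (innerSL ℂ (mulOp c (toHardy c)))
    rw [norm_inner_symm]
    refine h1.norm_le_of_bounded (b.hasSum_norm.mul_right _) fun k => ?_
    rw [map_smul, map_smul, norm_smul, innerSL_apply_apply, norm_inner_symm,
      hardyShift_pow_hardyBasis, hardyShift_pow_hardyBasis, inner_hardyBasis_left]
    exact mul_le_mul_of_nonneg_left (norm_sq_apply_le c _) (norm_nonneg _)
  have h1 := (hasSum_mulOp_apply a (toHardy b)).mapL (innerSL ℂ (mulOp c (toHardy c)))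
  rw [norm_inner_symm, mul_assoc]
  refine h1.norm_le_of_bounded (a.hasSum_norm.mul_right _) fun n => ?_
  rw [map_smul, norm_smul, innerSL_apply_apply, norm_inner_symm]
  exact mul_le_mul_of_nonneg_left (hb n) (norm_nonneg _)

/-- The Szegő nonlinearity on the Wiener algebra. -/
def szegoVec (a : Wiener) : Hardy := (mulOp a).adjoint (mulOp a (toHardy a))

lemma szegoVec_apply (a : Wiener) (n : ℕ) : szegoVec a n = szegoNL a n := by
  rw [szegoVec, ← (adjoint_mulOp_coeff a _ n).tsum_eq, szegoNL, toeplitzAB]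
  simp_rw [mulOp_coeff, coe_toHardy]

/-- The quartic energy `‖u²‖²`. -/
def quarticEnergy (a : Wiener) : ℝ := ‖mulOp a (toHardy a)‖ ^ 2

lemma inner_szegoVec_left (a b : Wiener) :
    ⟪szegoVec a, toHardy b⟫_ℂ = ⟪mulOp a (toHardy a), mulOp a (toHardy b)⟫_ℂ := by
  rw [szegoVec, ContinuousLinearMap.adjoint_inner_left]

lemma mulOp_add_toHardy_add (v w : Wiener) : mulOp (v + w) (toHardy (v + w)) =
    mulOp v (toHardy v) + (2 : ℂ) • mulOp v (toHardy w) + mulOp w (toHardy w) := by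
  rw [map_add, map_add, add_apply, map_add, map_add,
    mulOp_toHardy_comm w v, two_smul]
  abel

lemma quarticEnergy_add_ge (v w : Wiener) :
    quarticEnergy w / 2 - 10 * ‖v‖ ^ 2 * ‖toHardy w‖ ^ 2 ≤
      quarticEnergy (v + w) - quarticEnergy v - 4 * (⟪szegoVec v, toHardy w⟫_ℂ).re := by
  have h1 := norm_inner_mulOp_sq_le v v w
  have h2 := norm_mulOp_apply_le v (toHardy w)
  rw [inner_szegoVec_left]
  simp only [quarticEnergy, mulOp_add_toHardy_add]
  set p := mulOp v (toHardy v)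
  set q := mulOp v (toHardy w)
  set r := mulOp w (toHardy w)
  have h3 : ‖p + (2 : ℂ) • q + r‖ ^ 2 = ‖p‖ ^ 2 + 4 * ‖q‖ ^ 2 + ‖r‖ ^ 2 + 4 * (⟪p, q⟫_ℂ).re +
      2 * (⟪p, r⟫_ℂ).re + 4 * (⟪q, r⟫_ℂ).re := by
    rw [norm_add_sq (𝕜 := ℂ), norm_add_sq (𝕜 := ℂ), inner_add_left, inner_smul_right,
      inner_smul_left, norm_smul]
    simp
    ring
  have h4 : |(⟪p, r⟫_ℂ).re| ≤ ‖v‖ * ‖v‖ * ‖toHardy w‖ ^ 2 := (Complex.abs_re_le_norm _).trans h1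
  have h5 : |(⟪q, r⟫_ℂ).re| ≤ ‖q‖ * ‖r‖ :=
    (Complex.abs_re_le_norm _).trans (norm_inner_le_norm _ _)
  have h6 : ‖q‖ * ‖r‖ ≤ (‖v‖ * ‖toHardy w‖) * ‖r‖ := by gcongr
  rw [h3]
  nlinarith [abs_le.1 h4, abs_le.1 h5, sq_nonneg (‖r‖ - 4 * (‖v‖ * ‖toHardy w‖)), sq_nonneg ‖q‖]

/-- A curve in the Wiener algebra solving the cubic Szegő equation in the Hardy space. -/
structure IsWienerSolution (a : ℝ → Wiener) : Prop where
  contDiff : ContDiff ℝ 2 fun t => toHardy (a t)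
  hasDerivAt (t : ℝ) :
    HasDerivAt (fun τ => toHardy (a τ)) (-Complex.I • szegoVec (a t)) t

namespace IsWienerSolution

variable {a : ℝ → Wiener}

lemma differentiable_szegoVec (ha : IsWienerSolution a) :
    Differentiable ℝ fun t => szegoVec (a t) := by
  have h1 : (fun t => szegoVec (a t)) = fun t => Complex.I • deriv (fun τ => toHardy (a τ)) t := by
    funext t
    rw [(ha.hasDerivAt t).deriv, smul_smul]
    simp
  rw [h1]
  exact ((ha.contDiff.deriv' (n := 1) |>.differentiable (by simp))).const_smul Complex.I

lemma differentiable_quarticEnergy (ha : IsWienerSolution a) :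
    Differentiable ℝ fun t => quarticEnergy (a t) := by
  have h1 : (fun t => quarticEnergy (a t)) =
      fun t => (⟪szegoVec (a t), toHardy (a t)⟫_ℂ).re := by
    funext t
    rw [inner_szegoVec_left, quarticEnergy, ← inner_self_eq_norm_sq (𝕜 := ℂ)]
    rfl
  rw [h1]
  exact Complex.reCLM.differentiable.comp
    (ha.differentiable_szegoVec.inner ℂ (ha.contDiff.differentiable (by simp)))

lemma quarticEnergy_eq (ha : IsWienerSolution a) (t s : ℝ) :
    quarticEnergy (a t) = quarticEnergy (a s) := by
  refine is_const_of_deriv_eq_zero ha.differentiable_quarticEnergy (fun t => ?_) t s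
  have hu := ha.hasDerivAt t
  have h1 := (ha.differentiable_quarticEnergy t).hasDerivAt
  have h2 : HasDerivAt (fun τ => (⟪szegoVec (a t), toHardy (a τ) - toHardy (a t)⟫_ℂ).re)
      0 t := by
    have h3 := ((hasDerivAt_const t (szegoVec (a t))).inner ℂ
      (hu.sub_const (toHardy (a t))))
    have h4 := Complex.reCLM.hasFDerivAt.comp_hasDerivAt t h3
    refine h4.congr_deriv ?_
    rw [inner_zero_left, add_zero, inner_smul_right, inner_self_eq_norm_sq_to_K]
    simp [← Complex.ofReal_pow]
  have h5 : HasDerivAt (fun τ => ‖toHardy (a τ) - toHardy (a t)‖ ^ 2) 0 t := by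
    have := (hu.sub_const (toHardy (a t))).norm_sq
    simpa using this
  have h6 := (h1.sub (h2.const_mul 4)).add (h5.const_mul (10 * ‖a t‖ ^ 2))
  have h7 : IsLocalMin (fun τ => quarticEnergy (a τ) -
      4 * (⟪szegoVec (a t), toHardy (a τ) - toHardy (a t)⟫_ℂ).re +
      10 * ‖a t‖ ^ 2 * ‖toHardy (a τ) - toHardy (a t)‖ ^ 2) t := by
    refine Filter.Eventually.of_forall fun τ => ?_
    have h8 := quarticEnergy_add_ge (a t) (a τ - a t)
    rw [add_sub_cancel, map_sub] at h8
    have h9 : 0 ≤ quarticEnergy (a τ - a t) := sq_nonneg _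
    simp only [sub_self, inner_zero_right, Complex.zero_re, norm_zero]
    linarith
  have h10 := h7.hasDerivAt_eq_zero h6
  simpa using h10

end IsWienerSolution

lemma eq_zero_of_abs_deriv_le {Z Z' : ℝ → ℝ} {R K : ℝ} (hZ : ∀ t, HasDerivAt Z (Z' t) t)
    (h0 : Z 0 = 0) (hK : ∀ t, |t| ≤ R → |Z' t| ≤ K * |Z t|) {t : ℝ} (ht : |t| ≤ R) : Z t = 0 := by
  rcases le_total 0 t with h | h
  · refine eq_zero_of_abs_deriv_le_mul_abs_self_of_eq_zero_right (a := 0) (b := R) (K := K)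
      (fun s _ => (hZ s).continuousAt.continuousWithinAt) (fun s _ => (hZ s).hasDerivWithinAt) h0
      (fun s hs => hK s ?_) t ⟨h, (le_abs_self t).trans ht⟩
    rw [abs_of_nonneg hs.1]
    exact hs.2.le
  · have hd (s : ℝ) : HasDerivAt (fun r => Z (-r)) (-Z' (-s)) s :=
      (HasDerivAt.scomp s (hZ (-s)) (hasDerivAt_neg s)).congr_deriv (by simp)
    have := eq_zero_of_abs_deriv_le_mul_abs_self_of_eq_zero_right (f := fun s => Z (-s)) (a := 0)
      (b := R) (K := K)
      (fun s _ => (hd s).continuousAt.continuousWithinAt) (fun s _ => (hd s).hasDerivWithinAt)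
      (by simpa using h0)
      (fun s hs => by
        rw [norm_neg]
        refine hK (-s) ?_
        rw [abs_neg, abs_of_nonneg hs.1]
        exact hs.2.le) (-t) ⟨by linarith, (neg_le_abs t).trans ht⟩
    simpa using this

lemma mulOp_add_toHardy (v w b : Wiener) :
    mulOp (v + w) (toHardy b) = mulOp v (toHardy b) + mulOp b (toHardy w) := by
  rw [map_add, add_apply, mulOp_toHardy_comm w b]

lemma norm_inner_szegoVec_sub_le (v w : Wiener) {B : ℝ} (hv : ‖v‖ ≤ B) :
    ‖⟪szegoVec (v + w) - szegoVec v, toHardy w⟫_ℂ‖ ≤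
      5 * B ^ 2 * ‖toHardy w‖ ^ 2 + 3 * quarticEnergy w := by
  have h1 := norm_inner_mulOp_sq_le v v w
  have h2 := norm_mulOp_apply_le v (toHardy w)
  rw [inner_sub_left, inner_szegoVec_left, inner_szegoVec_left, mulOp_add_toHardy_add,
    mulOp_add_toHardy]
  simp only [quarticEnergy]
  set p := mulOp v (toHardy v)
  set q := mulOp v (toHardy w)
  set r := mulOp w (toHardy w)
  have h3 : ⟪p + (2 : ℂ) • q + r, q + r⟫_ℂ - ⟪p, q⟫_ℂ = ⟪(2 : ℂ) • q + r, q + r⟫_ℂ + ⟪p, r⟫_ℂ := by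
    simp only [inner_add_left, inner_add_right]
    ring
  have h4 : ‖(2 : ℂ) • q + r‖ ≤ 2 * ‖q‖ + ‖r‖ := by
    refine (norm_add_le _ _).trans_eq ?_
    rw [norm_smul]
    simp
  have hq : ‖q‖ ≤ B * ‖toHardy w‖ := h2.trans (by gcongr)
  have hB : ‖v‖ * ‖v‖ ≤ B ^ 2 := by
    rw [sq]
    exact mul_self_le_mul_self (norm_nonneg _) hv
  have hq2 : ‖q‖ ^ 2 ≤ B ^ 2 * ‖toHardy w‖ ^ 2 := by
    rw [← mul_pow]
    gcongr
  rw [h3]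
  calc ‖⟪(2 : ℂ) • q + r, q + r⟫_ℂ + ⟪p, r⟫_ℂ‖
      ≤ (2 * ‖q‖ + ‖r‖) * (‖q‖ + ‖r‖) + B ^ 2 * ‖toHardy w‖ ^ 2 := by
        refine (norm_add_le _ _).trans (add_le_add ?_ (h1.trans (by gcongr)))
        exact (norm_inner_le_norm _ _).trans (by gcongr; exact norm_add_le _ _)
    _ ≤ _ := by nlinarith [sq_nonneg (‖q‖ - ‖r‖)]

lemma hasDerivAt_mulOp_apply {b : ℝ → Wiener} {f : ℝ → Hardy} {b' : Wiener} {f' : Hardy} {t : ℝ}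
    (hb : HasDerivAt b b' t) (hf : HasDerivAt f f' t) :
    HasDerivAt (fun τ => mulOp (b τ) (f τ)) (mulOp b' (f t) + mulOp (b t) f') t :=
  HasDerivAt.clm_apply (((ContinuousLinearMap.restrictScalarsL ℂ Hardy Hardy ℝ ℝ).comp
    (mulOp.restrictScalars ℝ)).hasFDerivAt.comp_hasDerivAt t hb) hf

namespace IsWienerSolution

variable {a v : ℝ → Wiener}

lemma hasDerivAt_inner (ha : IsWienerSolution a) (hv : IsWienerSolution v) {v' : Wiener} {t : ℝ}
    (hd : HasDerivAt v v' t) :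
    HasDerivAt (fun τ => (⟪szegoVec (v τ), toHardy (a τ - v τ)⟫_ℂ).re)
      (-(⟪mulOp (v t) (toHardy v'), mulOp (a t - v t) (toHardy (a t - v t))⟫_ℂ).re
        - (⟪mulOp v' (toHardy (a t - v t)), (2 : ℂ) • mulOp (v t) (toHardy (a t - v t)) +
          mulOp (a t - v t) (toHardy (a t - v t))⟫_ℂ).re) t := by
  have hx : HasDerivAt (fun τ => toHardy (a τ - v τ))
      (-Complex.I • (szegoVec (a t) - szegoVec (v t))) t := by
    simp_rw [map_sub, smul_sub]
    exact (ha.hasDerivAt t).sub (hv.hasDerivAt t)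
  have hv' : toHardy v' = -Complex.I • szegoVec (v t) :=
    ((toHardy.restrictScalars ℝ).hasFDerivAt.comp_hasDerivAt t hd).unique (hv.hasDerivAt t)
  have hp : HasDerivAt (fun τ => mulOp (v τ) (toHardy (v τ)))
      ((2 : ℂ) • mulOp (v t) (toHardy v')) t := by
    refine (hasDerivAt_mulOp_apply hd
      ((toHardy.restrictScalars ℝ).hasFDerivAt.comp_hasDerivAt t hd)).congr_deriv ?_
    rw [two_smul]
    exact congrArg (· + mulOp (v t) (toHardy v')) (mulOp_toHardy_comm v' (v t))
  have hq := hasDerivAt_mulOp_apply hd hx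
  have hn : ⟪mulOp (v t) (toHardy (v t)), mulOp (v t) (-Complex.I • (szegoVec (a t) -
      szegoVec (v t)))⟫_ℂ = -⟪toHardy v', szegoVec (a t) - szegoVec (v t)⟫_ℂ := by
    rw [← ContinuousLinearMap.adjoint_inner_left, hv', inner_smul_left, inner_smul_right]
    simp [szegoVec]
  simp_rw [inner_szegoVec_left]
  refine (Complex.reCLM.hasFDerivAt.comp_hasDerivAt t (hp.inner ℂ hq)).congr_deriv ?_
  have hna : ⟪toHardy v', szegoVec (a t)⟫_ℂ = ⟪mulOp (v t) (toHardy v') +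
      mulOp v' (toHardy (a t - v t)), mulOp (v t) (toHardy (v t)) +
      (2 : ℂ) • mulOp (v t) (toHardy (a t - v t)) + mulOp (a t - v t) (toHardy (a t - v t))⟫_ℂ := by
    have h := mulOp_add_toHardy_add (v t) (a t - v t)
    rw [add_sub_cancel] at h
    rw [← h, ← mulOp_add_toHardy, add_sub_cancel, ← inner_conj_symm, inner_szegoVec_left,
      inner_conj_symm]
  have hnv : ⟪toHardy v', szegoVec (v t)⟫_ℂ =
      ⟪mulOp (v t) (toHardy v'), mulOp (v t) (toHardy (v t))⟫_ℂ := by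
    rw [← inner_conj_symm, inner_szegoVec_left, inner_conj_symm]
  rw [inner_add_right, hn, inner_sub_right, hna, hnv]
  simp only [inner_add_left, inner_add_right, inner_smul_left, inner_smul_right]
  rw [← inner_conj_symm (mulOp v' _) (mulOp (v t) (toHardy (v t)))]
  have h2 (z : ℂ) : ((2 : ℂ) * z).re = 2 * z.re := by simp
  simp only [Complex.reCLM_apply, Complex.add_re, Complex.sub_re, Complex.neg_re, Complex.conj_re,
    map_ofNat, h2]
  ring

theorem toHardy_eq (ha : IsWienerSolution a) (hv : IsWienerSolution v) (hd : ContDiff ℝ 1 v)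
    (h0 : toHardy (a 0) = toHardy (v 0)) (t : ℝ) : toHardy (a t) = toHardy (v t) := by
  have h0' : a 0 = v 0 := lp.ext (by rw [← coe_toHardy, h0, coe_toHardy])
  obtain ⟨B₁, hB₁⟩ := (isCompact_Icc (a := -|t|) (b := |t|)).exists_bound_of_continuousOn
    hd.continuous.continuousOn
  obtain ⟨B₂, hB₂⟩ := (isCompact_Icc (a := -|t|) (b := |t|)).exists_bound_of_continuousOn
    (hd.continuous_deriv le_rfl).continuousOn
  set B := max B₁ B₂
  have hvB (s : ℝ) (hs : |s| ≤ |t|) : ‖v s‖ ≤ B := (hB₁ s (abs_le.1 hs)).trans (le_max_left _ _)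
  have hvB' (s : ℝ) (hs : |s| ≤ |t|) : ‖deriv v s‖ ≤ B :=
    (hB₂ s (abs_le.1 hs)).trans (le_max_right _ _)
  have hB : 0 ≤ B := (norm_nonneg _).trans (hvB t le_rfl)
  have hy (s : ℝ) : HasDerivAt (fun τ => ‖toHardy (a τ - v τ)‖ ^ 2)
      (2 * (⟪toHardy (a s - v s), -Complex.I • (szegoVec (a s) - szegoVec (v s))⟫_ℂ).re) s := by
    have h1 := (ha.hasDerivAt s).sub (hv.hasDerivAt s)
    have h2 := Complex.reCLM.hasFDerivAt.comp_hasDerivAt s (h1.inner ℂ h1)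
    have h3 : (fun τ => ‖toHardy (a τ - v τ)‖ ^ 2) =
        fun τ => (⟪toHardy (a τ) - toHardy (v τ), toHardy (a τ) - toHardy (v τ)⟫_ℂ).re := by
      funext τ
      rw [← map_sub, ← inner_self_eq_norm_sq (𝕜 := ℂ)]
      rfl
    rw [h3]
    refine h2.congr_deriv ?_
    simp only [Pi.sub_apply, ← map_sub, ← smul_sub]
    rw [← inner_conj_symm (-Complex.I • _)]
    simp only [Complex.reCLM_apply, Complex.add_re, Complex.conj_re]
    ring
  have hZ (s : ℝ) :=
    ((ha.hasDerivAt_inner hv (hd.differentiable one_ne_zero s).hasDerivAt).const_mul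
    (-4)).add ((hy s).const_mul (10 * B ^ 2 + 1))
  have hlow (s : ℝ) (hs : |s| ≤ |t|) : quarticEnergy (a s - v s) / 2 + ‖toHardy (a s - v s)‖ ^ 2 ≤
      -4 * (⟪szegoVec (v s), toHardy (a s - v s)⟫_ℂ).re +
        (10 * B ^ 2 + 1) * ‖toHardy (a s - v s)‖ ^ 2 := by
    have h1 := quarticEnergy_add_ge (v s) (a s - v s)
    rw [add_sub_cancel, ha.quarticEnergy_eq s 0, hv.quarticEnergy_eq s 0, h0', sub_self] at h1
    have h2 : ‖v s‖ ^ 2 ≤ B ^ 2 := by gcongr; exact hvB s hs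
    nlinarith [sq_nonneg ‖toHardy (a s - v s)‖]
  have hzero := eq_zero_of_abs_deriv_le (R := |t|)
    (K := 14 * B ^ 2 + 4 + (10 * B ^ 2 + 1) * (10 * B ^ 2 + 12)) hZ (by simp [h0']) (fun s hs => ?_)
    (le_refl |t|)
  · have h1 := hlow t le_rfl
    have h2 : 0 ≤ quarticEnergy (a t - v t) := sq_nonneg _
    simp only [Pi.add_apply] at hzero
    have h3 : ‖toHardy (a t - v t)‖ ^ 2 = 0 := by nlinarith [sq_nonneg ‖toHardy (a t - v t)‖]
    rw [← sub_eq_zero, ← map_sub]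
    simpa using h3
  · have h1 := hlow s hs
    simp only [Pi.add_apply]
    have h2 := norm_inner_szegoVec_sub_le (v s) (a s - v s) (hvB s hs)
    rw [add_sub_cancel] at h2
    have h3 : |(⟪toHardy (a s - v s), -Complex.I • (szegoVec (a s) - szegoVec (v s))⟫_ℂ).re| ≤
        5 * B ^ 2 * ‖toHardy (a s - v s)‖ ^ 2 + 3 * quarticEnergy (a s - v s) := by
      refine le_trans ?_ h2
      rw [inner_smul_right, norm_inner_symm]
      refine (Complex.abs_re_le_norm _).trans ?_
      simp
    have h4 := norm_inner_mulOp_sq_le (v s) (deriv v s) (a s - v s)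
    have h5 := norm_mulOp_apply_le (deriv v s) (toHardy (a s - v s))
    have h6 := norm_mulOp_apply_le (v s) (toHardy (a s - v s))
    have h7 : quarticEnergy (a s - v s) = ‖mulOp (a s - v s) (toHardy (a s - v s))‖ ^ 2 := rfl
    set w := a s - v s
    set m := mulOp (deriv v s) (toHardy w)
    set q := mulOp (v s) (toHardy w)
    set r := mulOp w (toHardy w)
    set n := mulOp (v s) (toHardy (deriv v s))
    have h8 : |(⟪n, r⟫_ℂ).re| ≤ B ^ 2 * ‖toHardy w‖ ^ 2 := by
      refine ((Complex.abs_re_le_norm _).trans h4).trans ?_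
      rw [sq B]
      gcongr
      exacts [hvB s hs, hvB' s hs]
    have hm : ‖m‖ ≤ B * ‖toHardy w‖ := h5.trans (by gcongr; exact hvB' s hs)
    have hq : ‖q‖ ≤ B * ‖toHardy w‖ := h6.trans (by gcongr; exact hvB s hs)
    have h9 : |(⟪m, (2 : ℂ) • q + r⟫_ℂ).re| ≤
        5 / 2 * (B ^ 2 * ‖toHardy w‖ ^ 2) + quarticEnergy w / 2 := by
      refine ((Complex.abs_re_le_norm _).trans (norm_inner_le_norm _ _)).trans ?_
      calc ‖m‖ * ‖(2 : ℂ) • q + r‖ ≤ (B * ‖toHardy w‖) * (2 * (B * ‖toHardy w‖) + ‖r‖) := by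
            gcongr
            refine (norm_add_le _ _).trans ?_
            rw [norm_smul]
            simpa using hq
        _ ≤ _ := by
            rw [h7]
            nlinarith [sq_nonneg (B * ‖toHardy w‖ - ‖r‖)]
    have he : 0 ≤ quarticEnergy w := sq_nonneg _
    have hy0 : 0 ≤ ‖toHardy w‖ ^ 2 := sq_nonneg _
    set y := ‖toHardy w‖ ^ 2
    set e := quarticEnergy w
    rw [abs_of_nonneg (le_trans (by positivity) h1)]
    set Z := -4 * (⟪szegoVec (v s), toHardy w⟫_ℂ).re + (10 * B ^ 2 + 1) * y
    have hyZ : y ≤ Z := by linarith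
    have heZ : e ≤ 2 * Z := by linarith
    calc _ ≤ 4 * (B ^ 2 * y + (5 / 2 * (B ^ 2 * y) + e / 2)) +
          (10 * B ^ 2 + 1) * (2 * (5 * B ^ 2 * y + 3 * e)) := by
            refine (abs_add_le _ _).trans (add_le_add ?_ ?_)
            · rw [abs_mul, abs_neg, abs_of_pos (by norm_num : (0 : ℝ) < 4)]
              refine mul_le_mul_of_nonneg_left ?_ (by norm_num)
              refine (abs_sub _ _).trans (add_le_add ?_ h9)
              rwa [abs_neg]
            · rw [abs_mul, abs_of_nonneg (by positivity : 0 ≤ 10 * B ^ 2 + 1), abs_mul, abs_two]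
              gcongr
      _ ≤ 4 * (B ^ 2 * Z + (5 / 2 * (B ^ 2 * Z) + 2 * Z / 2)) +
          (10 * B ^ 2 + 1) * (2 * (5 * B ^ 2 * Z + 3 * (2 * Z))) := by gcongr
      _ = _ := by ring

end IsWienerSolution

/-- A finite-dimensional model of a Hankel operator: `A` plays the role of the backward shift,
`H` of the Hankel operator, and `e` of the projection of the constant function `1`. -/
structure HankelModel (E : Type*) [NormedAddCommGroup E] [InnerProductSpace ℂ E]
    [CompleteSpace E] where
  A : E →L[ℂ] E
  H : E →ₛₗ[starRingEnd ℂ] E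
  e : E
  inner_A (x y : E) : ⟪A x, A y⟫_ℂ = ⟪x, y⟫_ℂ - ⟪x, e⟫_ℂ * ⟪e, y⟫_ℂ
  inner_H (x y : E) : ⟪H x, y⟫_ℂ = ⟪H y, x⟫_ℂ
  A_H (x : E) : A (H x) = H (A.adjoint x)
  H_injective : Function.Injective H
  stable (z : ℂ) (x : E) : ‖z‖ = 1 → A x = z • x → x = 0

lemma exists_norm_pow_le_of_stable {E : Type*} [NormedAddCommGroup E] [InnerProductSpace ℂ E]
    [CompleteSpace E] [FiniteDimensional ℂ E] (A : E →L[ℂ] E) (hA : ‖A‖ ≤ 1)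
    (h : ∀ (z : ℂ) (x : E), ‖z‖ = 1 → A x = z • x → x = 0) :
    ∃ C r : ℝ, 0 ≤ C ∧ 0 ≤ r ∧ r < 1 ∧ ∀ n, ‖A ^ n‖ ≤ C * r ^ n := by
  rcases subsingleton_or_nontrivial E with hE | hE
  · refine ⟨0, 0, le_rfl, le_rfl, one_pos, fun n => ?_⟩
    rw [Subsingleton.elim (A ^ n) 0]
    simp
  obtain ⟨z, hz, hzr⟩ := spectrum.exists_nnnorm_eq_spectralRadius_of_nonempty
    (spectrum.nonempty_of_isAlgClosed_of_finiteDimensional ℂ A)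
  have hz1 : ‖z‖₊ < 1 := by
    have h1 : ‖z‖ ≤ 1 := (spectrum.norm_le_norm_of_mem hz).trans hA
    refine lt_of_le_of_ne h1 fun h2 => ?_
    have h3 : ‖z‖ = 1 := congrArg NNReal.toReal h2
    rw [spectrum.mem_iff, ContinuousLinearMap.isUnit_iff_bijective] at hz
    have h4 : Function.Injective (algebraMap ℂ (E →L[ℂ] E) z - A).toLinearMap := by
      refine (injective_iff_map_eq_zero _).2 fun x hx => h z x h3 ?_
      exact (sub_eq_zero.1 hx).symm
    exact hz ⟨h4, LinearMap.injective_iff_surjective.1 h4⟩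
  rw [← ENNReal.coe_lt_one_iff, hzr] at hz1
  obtain ⟨r, hr1, hr2⟩ := ENNReal.lt_iff_exists_nnreal_btwn.1 hz1
  have hev :=
    (spectrum.pow_nnnorm_pow_one_div_tendsto_nhds_spectralRadius A).eventually_lt_const hr1
  have hr0 : 0 < r := ENNReal.coe_pos.1 (bot_le.trans_lt hr1)
  have hO : (fun n => A ^ n) =O[Filter.atTop] fun n => (r : ℝ) ^ n := by
    refine Asymptotics.IsBigO.of_bound 1 ?_
    filter_upwards [hev, Filter.eventually_gt_atTop 0] with n hn hn0
    have hn1 : (0 : ℝ) < n := Nat.cast_pos.2 hn0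
    rw [← ENNReal.rpow_lt_rpow_iff hn1, ← ENNReal.rpow_mul, one_div_mul_cancel hn1.ne',
      ENNReal.rpow_one, ENNReal.rpow_natCast] at hn
    rw [one_mul, Real.norm_of_nonneg (by positivity)]
    exact_mod_cast hn.le
  obtain ⟨C, hC, hb⟩ := Asymptotics.bound_of_isBigO_nat_atTop hO
  refine ⟨C, r, hC.le, r.2, by exact_mod_cast hr2, fun n => ?_⟩
  have h1 : (r : ℝ) ^ n ≠ 0 := pow_ne_zero _ (by exact_mod_cast hr0.ne')
  refine (hb h1).trans_eq ?_
  rw [Real.norm_of_nonneg (by positivity)]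

lemma isUnit_one_sub_of_norm_pow_le {R : Type*} [NormedRing R] [CompleteSpace R] (a : R)
    {C r : ℝ} (hr0 : 0 ≤ r) (hr1 : r < 1) (h : ∀ n, ‖a ^ n‖ ≤ C * r ^ n) : IsUnit (1 - a) := by
  have hs : Summable fun n => a ^ n :=
    Summable.of_norm_bounded ((summable_geometric_of_lt_one hr0 hr1).mul_left C) h
  exact isUnit_iff_exists.2 ⟨_, hs.one_sub_mul_tsum_pow, hs.tsum_pow_mul_one_sub⟩

namespace HankelModel

variable {E : Type*} [NormedAddCommGroup E] [InnerProductSpace ℂ E] [CompleteSpace E]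
  (M : HankelModel E)

/-- The symbol of the model. -/
def u : E := M.H M.e

lemma norm_A_sq (x : E) : ‖M.A x‖ ^ 2 = ‖x‖ ^ 2 - ‖⟪M.e, x⟫_ℂ‖ ^ 2 := by
  have h := M.inner_A x x
  rw [← inner_conj_symm x M.e, ← Complex.normSq_eq_conj_mul_self, inner_self_eq_norm_sq_to_K,
    inner_self_eq_norm_sq_to_K, Complex.normSq_eq_norm_sq] at h
  refine Complex.ofReal_injective ?_
  push_cast at h ⊢
  exact h

lemma norm_A_le : ‖M.A‖ ≤ 1 := by
  refine ContinuousLinearMap.opNorm_le_bound _ zero_le_one fun x => ?_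
  rw [one_mul]
  refine le_of_sq_le_sq ?_ (norm_nonneg _)
  rw [norm_A_sq]
  linarith [sq_nonneg ‖⟪M.e, x⟫_ℂ‖]

lemma A_pow_H (n : ℕ) (x : E) : (M.A ^ n) (M.H x) = M.H ((M.A.adjoint ^ n) x) := by
  induction n generalizing x with
  | zero => rfl
  | succ n ih => rw [pow_succ, pow_succ, mul_apply_eq_comp, A_H, ih]; rfl

lemma adjoint_A_A (x : E) : M.A.adjoint (M.A x) = x - ⟪M.e, x⟫_ℂ • M.e := by
  refine ext_inner_left ℂ fun y => ?_
  rw [ContinuousLinearMap.adjoint_inner_right, inner_A, inner_sub_right, inner_smul_right]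
  ring

lemma inner_A_pow_left (n : ℕ) (x y : E) :
    ⟪(M.A ^ n) x, y⟫_ℂ = ⟪x, (M.A.adjoint ^ n) y⟫_ℂ := by
  rw [← ContinuousLinearMap.adjoint_inner_right, ← ContinuousLinearMap.star_eq_adjoint,
    ← ContinuousLinearMap.star_eq_adjoint, star_pow]

lemma inner_e_A_pow_H (n : ℕ) (x : E) : ⟪M.e, (M.A ^ n) (M.H x)⟫_ℂ = ⟪x, (M.A ^ n) M.u⟫_ℂ := by
  rw [← inner_conj_symm, ← inner_conj_symm x, u, A_pow_H M n M.e, inner_H,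
    inner_A_pow_left]

lemma exists_norm_A_pow_le [FiniteDimensional ℂ E] :
    ∃ C r : ℝ, 0 ≤ C ∧ 0 ≤ r ∧ r < 1 ∧ ∀ n, ‖M.A ^ n‖ ≤ C * r ^ n :=
  exists_norm_pow_le_of_stable M.A M.norm_A_le M.stable

/-- The generating operator `X ↦ S X A`. -/
def genOp (A : E →L[ℂ] E) : (E →L[ℂ] Wiener) →L[ℂ] (E →L[ℂ] Wiener) :=
  (ContinuousLinearMap.compL ℂ E Wiener Wiener wienerShift).comp
    ((ContinuousLinearMap.compL ℂ E E Wiener).flip A)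

lemma genOp_apply (A : E →L[ℂ] E) (X : E →L[ℂ] Wiener) :
    genOp A X = wienerShift ∘L X ∘L A := rfl

lemma genOp_pow_apply (A : E →L[ℂ] E) (n : ℕ) (X : E →L[ℂ] Wiener) :
    (genOp A ^ n) X = (wienerShift ^ n) ∘L X ∘L (A ^ n) := by
  induction n with
  | zero => rfl
  | succ n ih =>
    rw [pow_succ', mul_apply_eq_comp, ih, genOp_apply, pow_succ', pow_succ]
    rfl

lemma norm_genOp_pow_le (A : E →L[ℂ] E) (n : ℕ) : ‖genOp A ^ n‖ ≤ ‖A ^ n‖ := by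
  refine ContinuousLinearMap.opNorm_le_bound _ (norm_nonneg _) fun X => ?_
  rw [genOp_pow_apply]
  refine (ContinuousLinearMap.opNorm_comp_le _ _).trans ?_
  refine (mul_le_mul (norm_wienerShift_pow_le n) (ContinuousLinearMap.opNorm_comp_le _ _)
    (norm_nonneg _) zero_le_one).trans_eq ?_
  rw [one_mul, mul_comm]

lemma isUnit_one_sub_genOp [FiniteDimensional ℂ E] : IsUnit (1 - genOp M.A) := by
  obtain ⟨C, r, hC, hr0, hr1, h⟩ := M.exists_norm_A_pow_le
  exact isUnit_one_sub_of_norm_pow_le (R := (E →L[ℂ] Wiener) →L[ℂ] (E →L[ℂ] Wiener))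
    (genOp M.A) (C := C) hr0 hr1 fun n => (norm_genOp_pow_le _ n).trans (h n)

/-- The operator `x ↦ ⟪e, x⟫ · 1`. -/
def genInit (e : E) : E →L[ℂ] Wiener :=
  (innerSL ℂ e).smulRight (lp.single 1 0 (1 : ℂ) : Wiener)

/-- The generating function `x ↦ ∑ ⟪e, A ^ n x⟫ zⁿ`. -/
def gen (A : E →L[ℂ] E) (e : E) : E →L[ℂ] Wiener := Ring.inverse (1 - genOp A) (genInit e)

lemma gen_apply [FiniteDimensional ℂ E] (n : ℕ) (x : E) :
    gen M.A M.e x n = ⟪M.e, (M.A ^ n) x⟫_ℂ := by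
  have h : gen M.A M.e = genInit M.e + wienerShift ∘L gen M.A M.e ∘L M.A := by
    have h1 := DFunLike.congr_fun (Ring.mul_inverse_cancel _ M.isUnit_one_sub_genOp) (genInit M.e)
    rw [mul_apply_eq_comp] at h1
    exact sub_eq_iff_eq_add.1 h1
  induction n generalizing x with
  | zero =>
    rw [h]
    change (⟪M.e, x⟫_ℂ • (lp.single 1 0 (1 : ℂ) : Wiener)) 0 + 0 = _
    simp
  | succ n ih =>
    rw [h]
    change (⟪M.e, x⟫_ℂ • (lp.single 1 0 (1 : ℂ) : Wiener)) (n + 1) + gen M.A M.e (M.A x) n = _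
    rw [ih, pow_succ]
    simp

variable [FiniteDimensional ℂ E]

lemma hasSum_conj_inner_gen (x y : E) :
    HasSum (fun n => conj ⟪M.e, (M.A ^ n) x⟫_ℂ * ⟪M.e, (M.A ^ n) y⟫_ℂ)
      ⟪toHardy (gen M.A M.e x), toHardy (gen M.A M.e y)⟫_ℂ := by
  have h := lp.hasSum_inner (𝕜 := ℂ) (toHardy (gen M.A M.e x)) (toHardy (gen M.A M.e y))
  simpa only [toHardy_apply, gen_apply, RCLike.inner_apply, mul_comm] using h

lemma inner_toHardy_gen (x y : E) :
    ⟪toHardy (gen M.A M.e x), toHardy (gen M.A M.e y)⟫_ℂ = ⟪x, y⟫_ℂ := by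
  have hf (N : ℕ) : ∑ n ∈ Finset.range N, conj ⟪M.e, (M.A ^ n) x⟫_ℂ * ⟪M.e, (M.A ^ n) y⟫_ℂ =
      ⟪x, y⟫_ℂ - ⟪(M.A ^ N) x, (M.A ^ N) y⟫_ℂ := by
    induction N with
    | zero => simp
    | succ N ih =>
      rw [Finset.sum_range_succ, ih, pow_succ', mul_apply_eq_comp, mul_apply_eq_comp, inner_A,
        inner_conj_symm]
      ring
  obtain ⟨C, r, hC, hr0, hr1, hA⟩ := M.exists_norm_A_pow_le
  have hA0 : Filter.Tendsto (fun N => M.A ^ N) Filter.atTop (nhds 0) :=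
    squeeze_zero_norm hA
      (by simpa using (tendsto_pow_atTop_nhds_zero_of_lt_one hr0 hr1).const_mul C)
  have hA1 (z : E) : Filter.Tendsto (fun N => (M.A ^ N) z) Filter.atTop (nhds 0) :=
    ((ContinuousLinearMap.apply ℂ E z).continuous.tendsto' 0 0 (map_zero _)).comp hA0
  have hlim : Filter.Tendsto (fun N => ⟪x, y⟫_ℂ - ⟪(M.A ^ N) x, (M.A ^ N) y⟫_ℂ) Filter.atTop
      (nhds ⟪x, y⟫_ℂ) := by
    simpa using ((hA1 x).inner (hA1 y)).const_sub ⟪x, y⟫_ℂ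
  have h := (M.hasSum_conj_inner_gen x y).tendsto_sum_nat
  simp_rw [hf] at h
  exact tendsto_nhds_unique h hlim

end HankelModel

lemma adjoint_hardyShift_pow_apply (f : Hardy) (n k : ℕ) :
    (hardyShift.adjoint ^ n) f k = f (k + n) := by
  induction n generalizing k with
  | zero => rfl
  | succ n ih => rw [pow_succ', mul_apply_eq_comp, adjoint_hardyShift_apply, ih, Nat.add_assoc,
    Nat.add_comm 1]

lemma inner_adjoint_hardyShift_pow_left (f g : Hardy) (n : ℕ) :
    ⟪(hardyShift.adjoint ^ n) f, g⟫_ℂ = ⟪f, (hardyShift ^ n) g⟫_ℂ := by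
  rw [← ContinuousLinearMap.adjoint_inner_left, ← ContinuousLinearMap.star_eq_adjoint,
    ← ContinuousLinearMap.star_eq_adjoint, star_pow]

lemma adjoint_hardyShift_mulOp (a : Wiener) (h : Hardy) : hardyShift.adjoint (mulOp a h) =
    mulOp a (hardyShift.adjoint h) + h 0 • hardyShift.adjoint (toHardy a) := by
  refine lp.ext (funext fun n => ?_)
  rw [adjoint_hardyShift_apply, mulOp_coeff, lp.coeFn_add, Pi.add_apply, mulOp_coeff,
    lp.coeFn_smul, Pi.smul_apply, adjoint_hardyShift_apply, toHardy_apply, mulCoeff,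
    Finset.sum_range_succ, Nat.sub_self, mulCoeff, smul_eq_mul, mul_comm (h 0)]
  congr 1
  refine Finset.sum_congr rfl fun p hp => ?_
  rw [adjoint_hardyShift_apply, Nat.sub_add_comm (Finset.mem_range_succ_iff.1 hp)]

lemma adjoint_hardyShift_pow_mulOp (a : Wiener) (h : Hardy) (n : ℕ) :
    (hardyShift.adjoint ^ n) (mulOp a h) = mulOp a ((hardyShift.adjoint ^ n) h) +
      ∑ p ∈ Finset.range n, h p • (hardyShift.adjoint ^ (n - p)) (toHardy a) := by
  induction n with
  | zero => simp
  | succ n ih =>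
    rw [pow_succ', mul_apply_eq_comp, ih, map_add, adjoint_hardyShift_mulOp, map_sum,
      Finset.sum_range_succ, adjoint_hardyShift_pow_apply, zero_add, mul_apply_eq_comp,
      add_assoc, add_comm (h n • _)]
    congr 2
    · refine Finset.sum_congr rfl fun p hp => ?_
      rw [map_smul, Nat.sub_add_comm (Finset.mem_range.1 hp).le, pow_succ', mul_apply_eq_comp]
    · simp

lemma szegoVec_eq_inner (a : Wiener) (n : ℕ) : szegoVec a n =
    ⟪toHardy a, (hardyShift.adjoint ^ n) (mulOp a (toHardy a))⟫_ℂ := by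
  refine (adjoint_mulOp_coeff a _ n).unique ?_
  have h := lp.hasSum_inner (𝕜 := ℂ) (toHardy a) ((hardyShift.adjoint ^ n) (mulOp a (toHardy a)))
  simpa only [toHardy_apply, adjoint_hardyShift_pow_apply, RCLike.inner_apply, mul_comm,
    add_comm] using h

namespace HankelModel

variable {E : Type*} [NormedAddCommGroup E] [InnerProductSpace ℂ E] [CompleteSpace E]
  [FiniteDimensional ℂ E] (M : HankelModel E)

lemma adjoint_hardyShift_pow_gen (n : ℕ) (x : E) :
    (hardyShift.adjoint ^ n) (toHardy (gen M.A M.e x)) = toHardy (gen M.A M.e ((M.A ^ n) x)) := by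
  refine lp.ext (funext fun k => ?_)
  rw [adjoint_hardyShift_pow_apply, toHardy_apply, toHardy_apply, gen_apply, gen_apply, pow_add]
  rfl

lemma inner_mulOp_gen (x : E) :
    ⟪toHardy (gen M.A M.e M.u), mulOp (gen M.A M.e M.u) (toHardy (gen M.A M.e x))⟫_ℂ =
      ⟪M.H M.u, x⟫_ℂ := by
  rw [mulOp_toHardy_comm]
  have h := (hasSum_mulOp_apply (gen M.A M.e x) (toHardy (gen M.A M.e M.u))).mapL
    (innerSL ℂ (toHardy (gen M.A M.e M.u)))
  have hr (r : ℕ) : innerSL ℂ (toHardy (gen M.A M.e M.u))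
      (gen M.A M.e x r • (hardyShift ^ r) (toHardy (gen M.A M.e M.u))) =
      conj ⟪M.e, (M.A ^ r) (M.H M.u)⟫_ℂ * ⟪M.e, (M.A ^ r) x⟫_ℂ := by
    rw [innerSL_apply_apply, inner_smul_right, gen_apply, mul_comm]
    congr 1
    rw [inner_e_A_pow_H, ← inner_toHardy_gen M M.u, ← adjoint_hardyShift_pow_gen, inner_conj_symm]
    exact (inner_adjoint_hardyShift_pow_left _ _ _).symm
  simp_rw [hr] at h
  rw [← inner_toHardy_gen M (M.H M.u) x]
  exact h.unique (M.hasSum_conj_inner_gen (M.H M.u) x)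

lemma szegoVec_gen (n : ℕ) : szegoVec (gen M.A M.e M.u) n =
    ⟪M.e, (M.A ^ n) (M.H (M.H M.u))⟫_ℂ +
      ∑ p ∈ Finset.range n, ⟪M.e, (M.A ^ p) M.u⟫_ℂ * ⟪M.u, (M.A ^ (n - p)) M.u⟫_ℂ := by
  rw [szegoVec_eq_inner, adjoint_hardyShift_pow_mulOp, inner_add_right, inner_sum,
    adjoint_hardyShift_pow_gen, inner_mulOp_gen, inner_e_A_pow_H]
  congr 1
  refine Finset.sum_congr rfl fun p _ => ?_
  rw [inner_smul_right, adjoint_hardyShift_pow_gen, inner_toHardy_gen, toHardy_apply, gen_apply]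

end HankelModel

lemma range_hankelLM (v : ℕ → ℂ) : LinearMap.range (hankelLM v) =
    Submodule.span ℂ (Set.range fun p n => v (n + p)) := by
  rw [← Finsupp.range_linearCombination]
  congr 1

namespace HankelModel

variable {E : Type*} [NormedAddCommGroup E] [InnerProductSpace ℂ E] [CompleteSpace E]
  (M : HankelModel E)

/-- The sequence of coefficients `⟪e, A ^ n x⟫`. -/
def coeffMap : E →ₗ[ℂ] ℕ → ℂ :=
  LinearMap.pi fun n => ((innerSL ℂ M.e).comp (M.A ^ n)).toLinearMap

lemma coeffMap_apply (x : E) (n : ℕ) : M.coeffMap x n = ⟪M.e, (M.A ^ n) x⟫_ℂ := rfl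

lemma range_hankelLM_coeffMap (x : E) : LinearMap.range (hankelLM (M.coeffMap x)) =
    (Submodule.span ℂ (Set.range fun p => (M.A ^ p) x)).map M.coeffMap := by
  rw [range_hankelLM, Submodule.map_span, ← Set.range_comp]
  congr 2
  funext p n
  simp only [Function.comp_apply, coeffMap_apply, pow_add, mul_apply_eq_comp]

variable [FiniteDimensional ℂ E]

lemma coeffMap_eq_gen (x : E) : M.coeffMap x = gen M.A M.e x :=
  funext fun n => (M.gen_apply n x).symm

lemma coeffMap_injective : Function.Injective M.coeffMap := by
  refine (injective_iff_map_eq_zero _).2 fun x hx => ?_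
  have h : gen M.A M.e x = 0 := lp.ext (by rw [← coeffMap_eq_gen, hx]; rfl)
  rw [← inner_self_eq_zero (𝕜 := ℂ), ← inner_toHardy_gen, h, map_zero, inner_zero_left]

lemma span_A_pow_u : Submodule.span ℂ (Set.range fun p => (M.A ^ p) M.u) = ⊤ := by
  rw [← Submodule.orthogonal_eq_bot_iff, Submodule.eq_bot_iff]
  intro x hx
  refine M.H_injective ?_
  refine M.coeffMap_injective (funext fun n => ?_)
  rw [coeffMap_apply, inner_e_A_pow_H, map_zero, map_zero, Pi.zero_apply]
  have hn : (M.A ^ n) M.u ∈ Submodule.span ℂ (Set.range fun p => (M.A ^ p) M.u) :=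
    Submodule.subset_span ⟨n, rfl⟩
  exact Submodule.inner_left_of_mem_orthogonal hn hx

lemma span_A_pow_A_u : Submodule.span ℂ (Set.range fun p => (M.A ^ p) (M.A M.u)) =
    LinearMap.range M.A.toLinearMap := by
  rw [LinearMap.range_eq_map, ← span_A_pow_u, Submodule.map_span, ← Set.range_comp]
  congr 2
  funext p
  change (M.A ^ p * M.A) M.u = (M.A * M.A ^ p) M.u
  rw [← pow_succ, ← pow_succ']

lemma hankelRank_coeffMap_u : hankelRank (M.coeffMap M.u) = Module.finrank ℂ E := by
  rw [hankelRank, range_hankelLM_coeffMap, span_A_pow_u,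
    (Submodule.equivMapOfInjective _ M.coeffMap_injective ⊤).symm.finrank_eq, finrank_top]

lemma hankelRank_coeffMap_u_succ : hankelRank (fun n => M.coeffMap M.u (n + 1)) =
    Module.finrank ℂ (LinearMap.range M.A.toLinearMap) := by
  have h : (fun n => M.coeffMap M.u (n + 1)) = M.coeffMap (M.A M.u) := by
    funext n
    rw [coeffMap_apply, coeffMap_apply, pow_succ]
    rfl
  rw [h, hankelRank, range_hankelLM_coeffMap, span_A_pow_A_u,
    (Submodule.equivMapOfInjective _ M.coeffMap_injective _).symm.finrank_eq]

lemma inHs_coeffMap (x : E) : InHs (1 / 2) (M.coeffMap x) := by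
  obtain ⟨C, r, hC, hr0, hr1, hA⟩ := M.exists_norm_A_pow_le
  have hb (n : ℕ) : ‖M.coeffMap x n‖ ≤ ‖M.e‖ * (C * ‖x‖) * r ^ n := by
    refine (norm_inner_le_norm _ _).trans ?_
    rw [mul_assoc, mul_right_comm]
    gcongr
    exact (ContinuousLinearMap.le_opNorm _ _).trans (by gcongr; exact hA n)
  set D := ‖M.e‖ * (C * ‖x‖)
  have hr2 : ‖r ^ 2‖ < 1 := by
    rw [Real.norm_of_nonneg (by positivity)]
    exact pow_lt_one₀ hr0 hr1 two_ne_zero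
  have hs := ((summable_pow_mul_geometric_of_norm_lt_one 0 hr2).add
    (summable_pow_mul_geometric_of_norm_lt_one 1 hr2)).mul_left (D ^ 2)
  refine Summable.of_nonneg_of_le (fun n => by positivity) (fun n => ?_) hs
  have h1 : ((1 : ℝ) + (n : ℝ) ^ 2) ^ (1 / 2 : ℝ) ≤ 1 + n := by
    rw [← Real.sqrt_eq_rpow]
    refine Real.sqrt_le_iff.2 ⟨by positivity, ?_⟩
    nlinarith [(Nat.cast_nonneg n : (0 : ℝ) ≤ n)]
  calc _ ≤ (1 + n) * (D * r ^ n) ^ 2 := by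
        gcongr
        exact hb n
    _ = _ := by ring

lemma inV_coeffMap_u {d : ℕ} (h1 : Module.finrank ℂ E = (d + 1) / 2)
    (h2 : Module.finrank ℂ (LinearMap.range M.A.toLinearMap) = d / 2) :
    InV d (M.coeffMap M.u) := by
  refine ⟨M.inHs_coeffMap _, ?_, M.hankelRank_coeffMap_u.trans h1,
    M.hankelRank_coeffMap_u_succ.trans h2⟩
  rw [range_hankelLM_coeffMap]
  infer_instance

end HankelModel

section SpectralMap

variable {E : Type*} [NormedAddCommGroup E] [InnerProductSpace ℂ E] [FiniteDimensional ℂ E]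
  {T : E →ₗ[ℂ] E} (hT : T.IsSymmetric)

/-- The function `θ` of a symmetric operator. -/
def spectralMap (θ : ℝ → ℂ) : E →L[ℂ] E :=
  ∑ i, θ (hT.eigenvalues rfl i) •
    InnerProductSpace.rankOne ℂ (hT.eigenvectorBasis rfl i) (hT.eigenvectorBasis rfl i)

lemma spectralMap_apply (θ : ℝ → ℂ) (x : E) : spectralMap hT θ x =
    ∑ i, θ (hT.eigenvalues rfl i) •
      ⟪hT.eigenvectorBasis rfl i, x⟫_ℂ • hT.eigenvectorBasis rfl i := by
  simp [spectralMap]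

lemma spectralMap_apply_of_eigenvector (θ : ℝ → ℂ) {x : E} {μ : ℝ} (hx : T x = (μ : ℂ) • x) :
    spectralMap hT θ x = θ μ • x := by
  rw [spectralMap_apply]
  conv_rhs => rw [← (hT.eigenvectorBasis rfl).sum_repr' x, Finset.smul_sum]
  refine Finset.sum_congr rfl fun i _ => ?_
  rcases eq_or_ne (⟪hT.eigenvectorBasis rfl i, x⟫_ℂ) 0 with h | h
  · rw [h, zero_smul, smul_zero, smul_zero]
  · have h1 := hT (hT.eigenvectorBasis rfl i) x
    rw [hT.apply_eigenvectorBasis, hx, inner_smul_left, inner_smul_right] at h1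
    have h2 := mul_right_cancel₀ h h1
    rw [RCLike.conj_ofReal] at h2
    rw [show hT.eigenvalues rfl i = μ from Complex.ofReal_injective h2]

lemma spectralMap_apply_basis (θ : ℝ → ℂ) (i) : spectralMap hT θ (hT.eigenvectorBasis rfl i) =
    θ (hT.eigenvalues rfl i) • hT.eigenvectorBasis rfl i :=
  spectralMap_apply_of_eigenvector hT θ (hT.apply_eigenvectorBasis rfl i)

lemma spectralMap_mul (θ η : ℝ → ℂ) (x : E) :
    spectralMap hT θ (spectralMap hT η x) = spectralMap hT (fun μ => θ μ * η μ) x := by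
  rw [spectralMap_apply _ η, map_sum, spectralMap_apply]
  refine Finset.sum_congr rfl fun i _ => ?_
  rw [map_smul, map_smul, spectralMap_apply_basis]
  module

lemma spectralMap_one (x : E) : spectralMap hT (fun _ => 1) x = x := by
  rw [spectralMap_apply]
  simp_rw [one_smul]
  exact (hT.eigenvectorBasis rfl).sum_repr' x

lemma spectralMap_ofReal (x : E) : spectralMap hT (fun μ => (μ : ℂ)) x = T x := by
  conv_rhs => rw [← (hT.eigenvectorBasis rfl).sum_repr' x, map_sum]
  rw [spectralMap_apply]
  refine Finset.sum_congr rfl fun i _ => ?_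
  rw [map_smul, hT.apply_eigenvectorBasis]
  exact smul_comm _ _ _

lemma inner_spectralMap_left (θ : ℝ → ℂ) (x y : E) :
    ⟪spectralMap hT θ x, y⟫_ℂ = ⟪x, spectralMap hT (fun μ => conj (θ μ)) y⟫_ℂ := by
  rw [spectralMap_apply, spectralMap_apply, sum_inner, inner_sum]
  refine Finset.sum_congr rfl fun i _ => ?_
  rw [inner_smul_left, inner_smul_left, inner_smul_right, inner_smul_right, inner_conj_symm]
  ring

lemma spectralMap_comm_antilinear (θ : ℝ → ℂ) (X : E →ₛₗ[starRingEnd ℂ] E)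
    (hX : ∀ x, T (X x) = X (T x)) (x : E) :
    X (spectralMap hT θ x) = spectralMap hT (fun μ => conj (θ μ)) (X x) := by
  conv_rhs => rw [← (hT.eigenvectorBasis rfl).sum_repr' x, map_sum, map_sum]
  rw [spectralMap_apply, map_sum]
  refine Finset.sum_congr rfl fun i _ => ?_
  have h : T (X (hT.eigenvectorBasis rfl i)) =
      ((hT.eigenvalues rfl i : ℝ) : ℂ) • X (hT.eigenvectorBasis rfl i) := by
    rw [hX, hT.apply_eigenvectorBasis, map_smulₛₗ]
    simp
  rw [map_smulₛₗ, map_smulₛₗ, map_smulₛₗ, RingHom.id_apply, spectralMap_apply_of_eigenvector hT _ h]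
  exact smul_comm _ _ _

lemma spectralMap_conj_mul_self {θ : ℝ → ℂ} (hθ : ∀ μ, conj (θ μ) * θ μ = 1) (x : E) :
    spectralMap hT (fun μ => conj (θ μ)) (spectralMap hT θ x) = x := by
  rw [spectralMap_mul]
  simp_rw [hθ]
  exact spectralMap_one hT x

lemma spectralMap_mul_conj_self {θ : ℝ → ℂ} (hθ : ∀ μ, conj (θ μ) * θ μ = 1) (x : E) :
    spectralMap hT θ (spectralMap hT (fun μ => conj (θ μ)) x) = x := by
  rw [spectralMap_mul]
  simp_rw [mul_comm (θ _), hθ]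
  exact spectralMap_one hT x

lemma inner_spectralMap_spectralMap {θ : ℝ → ℂ} (hθ : ∀ μ, conj (θ μ) * θ μ = 1) (x y : E) :
    ⟪spectralMap hT θ x, spectralMap hT θ y⟫_ℂ = ⟪x, y⟫_ℂ := by
  rw [inner_spectralMap_left, spectralMap_conj_mul_self hT hθ]

end SpectralMap

lemma isSymmetric_comp_self_of_antilinear {E : Type*} [NormedAddCommGroup E]
    [InnerProductSpace ℂ E] (X : E →ₛₗ[starRingEnd ℂ] E) (hX : ∀ x y, ⟪X x, y⟫_ℂ = ⟪X y, x⟫_ℂ) :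
    (X.comp X : E →ₗ[ℂ] E).IsSymmetric := fun x y => by
  change ⟪X (X x), y⟫_ℂ = ⟪x, X (X y)⟫_ℂ
  rw [hX (X x) y, ← inner_conj_symm x, hX (X y) x, inner_conj_symm]

namespace HankelModel

variable {E : Type*} [NormedAddCommGroup E] [InnerProductSpace ℂ E] [CompleteSpace E]
  (M : HankelModel E)

/-- The shifted Hankel operator of the model. -/
def K : E →ₛₗ[starRingEnd ℂ] E := M.A.toLinearMap.comp M.H

lemma K_apply (x : E) : M.K x = M.A (M.H x) := rfl

lemma inner_K (x y : E) : ⟪M.K x, y⟫_ℂ = ⟪M.K y, x⟫_ℂ := by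
  rw [K_apply, ← ContinuousLinearMap.adjoint_inner_right, inner_H, ← A_H, ← K_apply]

lemma isSymmetric_H_sq : (M.H.comp M.H : E →ₗ[ℂ] E).IsSymmetric :=
  isSymmetric_comp_self_of_antilinear M.H M.inner_H

lemma isSymmetric_K_sq : (M.K.comp M.K : E →ₗ[ℂ] E).IsSymmetric :=
  isSymmetric_comp_self_of_antilinear M.K M.inner_K

lemma K_K (x : E) : M.K (M.K x) = M.H (M.H x) - ⟪M.u, x⟫_ℂ • M.u := by
  rw [K_apply, K_apply, A_H, adjoint_A_A, map_sub, map_smulₛₗ, inner_conj_symm, inner_H]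
  rfl

variable [FiniteDimensional ℂ E]

/-- The function `θ` of `H²`. -/
def twistH (θ : ℝ → ℂ) : E →L[ℂ] E := spectralMap M.isSymmetric_H_sq θ

/-- The function `θ` of `K²`. -/
def twistK (θ : ℝ → ℂ) : E →L[ℂ] E := spectralMap M.isSymmetric_K_sq θ

lemma H_twistH (θ : ℝ → ℂ) (x : E) :
    M.H (M.twistH θ x) = M.twistH (fun μ => conj (θ μ)) (M.H x) :=
  spectralMap_comm_antilinear _ _ _ (fun _ => rfl) x

lemma K_twistK (θ : ℝ → ℂ) (x : E) :
    M.K (M.twistK θ x) = M.twistK (fun μ => conj (θ μ)) (M.K x) :=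
  spectralMap_comm_antilinear _ _ _ (fun _ => rfl) x

/-- The backward shift of the twisted model. -/
def twistA (θ : ℝ → ℂ) : E →L[ℂ] E :=
  M.twistH (fun μ => conj (θ μ)) ∘L M.twistK θ ∘L M.A

lemma twistA_apply (θ : ℝ → ℂ) (x : E) :
    M.twistA θ x = M.twistH (fun μ => conj (θ μ)) (M.twistK θ (M.A x)) := rfl

lemma inner_twistA_left (θ : ℝ → ℂ) (x y : E) : ⟪M.twistA θ x, y⟫_ℂ =
    ⟪x, M.A.adjoint (M.twistK (fun μ => conj (θ μ)) (M.twistH θ y))⟫_ℂ := by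
  rw [twistA_apply, twistH, inner_spectralMap_left, twistK, inner_spectralMap_left,
    ContinuousLinearMap.adjoint_inner_right]
  simp_rw [Complex.conj_conj]
  rfl

lemma adjoint_twistA_apply (θ : ℝ → ℂ) (y : E) : (M.twistA θ).adjoint y =
    M.A.adjoint (M.twistK (fun μ => conj (θ μ)) (M.twistH θ y)) := by
  refine ext_inner_left ℂ fun x => ?_
  rw [ContinuousLinearMap.adjoint_inner_right, inner_twistA_left]

lemma twistA_H (θ : ℝ → ℂ) (x : E) :
    M.twistA θ (M.twistH (fun μ => conj (θ μ)) (M.H x)) =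
      M.twistH (fun μ => conj (θ μ)) (M.H ((M.twistA θ).adjoint x)) := by
  rw [adjoint_twistA_apply, ← A_H, ← K_apply, K_twistK, ← H_twistH, twistA_apply, ← K_apply]
  simp_rw [Complex.conj_conj]

lemma inner_twistA (θ : ℝ → ℂ) (hθ : ∀ μ, conj (θ μ) * θ μ = 1) (x y : E) :
    ⟪M.twistA θ x, M.twistA θ y⟫_ℂ = ⟪x, y⟫_ℂ - ⟪x, M.e⟫_ℂ * ⟪M.e, y⟫_ℂ := by
  have hθ' (μ : ℝ) : conj (conj (θ μ)) * conj (θ μ) = 1 := by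
    rw [Complex.conj_conj, mul_comm, hθ]
  rw [twistA_apply, twistA_apply, twistH, inner_spectralMap_spectralMap _ hθ', twistK,
    inner_spectralMap_spectralMap _ hθ, inner_A]

lemma twistH_H_twistH_H (θ : ℝ → ℂ) (hθ : ∀ μ, conj (θ μ) * θ μ = 1) (x : E) :
    M.twistH (fun μ => conj (θ μ)) (M.H (M.twistH (fun μ => conj (θ μ)) (M.H x))) =
      M.H (M.H x) := by
  rw [H_twistH]
  simp_rw [Complex.conj_conj]
  exact spectralMap_conj_mul_self _ hθ _

end HankelModel

lemma inner_eq_zero_and_adjoint_apply_of_norm_eq_one {E : Type*} [NormedAddCommGroup E]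
    [InnerProductSpace ℂ E] [CompleteSpace E] {A : E →L[ℂ] E} {e : E}
    (hA : ∀ x y, ⟪A x, A y⟫_ℂ = ⟪x, y⟫_ℂ - ⟪x, e⟫_ℂ * ⟪e, y⟫_ℂ) {z : ℂ} (hz : ‖z‖ = 1) {x : E}
    (hx : A x = z • x) : ⟪e, x⟫_ℂ = 0 ∧ A.adjoint x = conj z • x := by
  have hzz : conj z * z = 1 := by
    rw [← Complex.normSq_eq_conj_mul_self, Complex.normSq_eq_norm_sq, hz]
    simp
  have h1 : ⟪e, x⟫_ℂ = 0 := by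
    have h := hA x x
    rw [hx, inner_smul_left, inner_smul_right, ← mul_assoc, hzz, one_mul, eq_comm, sub_eq_self,
      ← inner_conj_symm x, ← Complex.normSq_eq_conj_mul_self] at h
    exact Complex.normSq_eq_zero.1 (by exact_mod_cast h)
  refine ⟨h1, ?_⟩
  have h2 : z • A.adjoint x = x := by
    refine ext_inner_left ℂ fun y => ?_
    rw [← map_smul, ← hx, ContinuousLinearMap.adjoint_inner_right, hA, h1, mul_zero, sub_zero]
  rw [← h2, smul_smul, hzz, one_smul, h2]

namespace HankelModel

variable {E : Type*} [NormedAddCommGroup E] [InnerProductSpace ℂ E] [CompleteSpace E]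
  (M : HankelModel E) [FiniteDimensional ℂ E]

lemma twistA_stable (θ : ℝ → ℂ) (hθ : ∀ μ, conj (θ μ) * θ μ = 1) (z : ℂ) (x : E) (hz : ‖z‖ = 1)
    (hx : M.twistA θ x = z • x) : x = 0 := by
  by_contra hx0
  set F : Submodule ℂ E := Module.End.eigenspace (M.twistA θ).toLinearMap z
  have hF {y : E} : y ∈ F ↔ M.twistA θ y = z • y := Module.End.mem_eigenspace_iff
  have hHF {y : E} (hy : y ∈ F) : M.twistH (fun μ => conj (θ μ)) (M.H y) ∈ F := by
    rw [hF] at hy ⊢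
    rw [twistA_H, (inner_eq_zero_and_adjoint_apply_of_norm_eq_one (M.inner_twistA θ hθ) hz hy).2,
      map_smulₛₗ, Complex.conj_conj, map_smul]
  have hPF (y : E) (hy : y ∈ F) : (M.H.comp M.H : E →ₗ[ℂ] E) y ∈ F := by
    have h := hHF (hHF hy)
    rwa [twistH_H_twistH_H _ _ hθ] at h
  have : Nontrivial F := ⟨⟨x, hF.2 hx⟩, 0, fun h => hx0 (congrArg Subtype.val h)⟩
  obtain ⟨ν, hν⟩ := Module.End.exists_eigenvalue ((M.H.comp M.H : E →ₗ[ℂ] E).restrict hPF)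
  obtain ⟨h, hh⟩ := hν.exists_hasEigenvector
  have hh0 : (h : E) ≠ 0 := fun h0 => hh.2 (Subtype.ext h0)
  have hhν : (M.H.comp M.H : E →ₗ[ℂ] E) h = ν • (h : E) := congrArg Subtype.val hh.apply_eq_smul
  have hreal : conj ν = ν := M.isSymmetric_H_sq.conj_eigenvalue_eq_self
    (Module.End.hasEigenvalue_of_hasEigenvector ⟨Module.End.mem_eigenspace_iff.2 hhν, hh0⟩)
  obtain ⟨μ, rfl⟩ := Complex.conj_eq_iff_real.1 hreal
  have hU : M.twistH θ h = θ μ • (h : E) := spectralMap_apply_of_eigenvector _ θ hhν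
  have hθ0 : conj (θ μ) ≠ 0 := left_ne_zero_of_mul_eq_one (hθ μ)
  have hu : ⟪M.u, (h : E)⟫_ℂ = 0 := by
    have h1 := (inner_eq_zero_and_adjoint_apply_of_norm_eq_one (M.inner_twistA θ hθ) hz
      (hF.1 (hHF h.2))).1
    rw [← H_twistH, hU, map_smulₛₗ, inner_smul_right] at h1
    have h2 := (mul_eq_zero.1 h1).resolve_left hθ0
    rw [← inner_conj_symm, inner_H] at h2
    exact (map_eq_zero _).1 h2
  have hK : (M.K.comp M.K : E →ₗ[ℂ] E) h = (μ : ℂ) • (h : E) := by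
    have h1 := M.K_K h
    rw [hu, zero_smul, sub_zero] at h1
    exact h1.trans hhν
  have hV : M.twistK (fun μ => conj (θ μ)) h = conj (θ μ) • (h : E) :=
    spectralMap_apply_of_eigenvector _ (fun μ => conj (θ μ)) hK
  refine hh0 (M.stable z h hz ?_)
  have h1 := congrArg (M.twistH θ) (hF.1 h.2)
  rw [twistA_apply, twistH, twistH, spectralMap_mul_conj_self _ hθ, ← twistH, map_smul, hU] at h1
  have h2 := congrArg (M.twistK fun μ => conj (θ μ)) h1
  rw [twistK, twistK, spectralMap_conj_mul_self _ hθ, ← twistK, map_smul, map_smul, hV] at h2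
  rw [h2, smul_smul (θ μ), mul_comm (θ μ), hθ, one_smul]

/-- The twisted model. -/
def twist (θ : ℝ → ℂ) (hθ : ∀ μ, conj (θ μ) * θ μ = 1) : HankelModel E where
  A := M.twistA θ
  H := (M.twistH fun μ => conj (θ μ)).toLinearMap.comp M.H
  e := M.e
  inner_A := M.inner_twistA θ hθ
  inner_H x y := by
    change ⟪M.twistH _ (M.H x), y⟫_ℂ = ⟪M.twistH _ (M.H y), x⟫_ℂ
    rw [twistH, inner_spectralMap_left, inner_H, ← twistH, H_twistH]
    simp_rw [Complex.conj_conj]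
    rfl
  A_H := M.twistA_H θ
  H_injective := by
    refine Function.Injective.comp (g := M.twistH fun μ => conj (θ μ)) ?_ M.H_injective
    exact Function.LeftInverse.injective (g := M.twistH θ) (spectralMap_mul_conj_self _ hθ)
  stable := M.twistA_stable θ hθ

lemma twist_H_H (θ : ℝ → ℂ) (hθ : ∀ μ, conj (θ μ) * θ μ = 1) (x : E) :
    (M.twist θ hθ).H ((M.twist θ hθ).H x) = M.H (M.H x) := M.twistH_H_twistH_H θ hθ x

lemma finrank_range_twistA (θ : ℝ → ℂ) (hθ : ∀ μ, conj (θ μ) * θ μ = 1) :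
    Module.finrank ℂ (LinearMap.range (M.twistA θ).toLinearMap) =
      Module.finrank ℂ (LinearMap.range M.A.toLinearMap) := by
  have h1 : Function.Injective (M.twistH fun μ => conj (θ μ)) :=
    Function.LeftInverse.injective (g := M.twistH θ) (spectralMap_mul_conj_self _ hθ)
  have h2 : Function.Injective (M.twistK θ) :=
    Function.LeftInverse.injective (g := M.twistK fun μ => conj (θ μ))
      (spectralMap_conj_mul_self _ hθ)
  have h : Function.Injective ((M.twistH fun μ => conj (θ μ)).toLinearMap ∘ₗ
      (M.twistK θ).toLinearMap) := fun x y hxy => h2 (h1 hxy)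
  have h3 : (M.twistA θ).toLinearMap = ((M.twistH fun μ => conj (θ μ)).toLinearMap ∘ₗ
      (M.twistK θ).toLinearMap) ∘ₗ M.A.toLinearMap := rfl
  rw [h3, LinearMap.range_comp]
  exact (Submodule.equivMapOfInjective _ h _).finrank_eq.symm

end HankelModel

lemma ContDiff.ringInverse_one_sub_apply {P F : Type*} [NormedAddCommGroup P] [NormedSpace ℝ P]
    [NormedAddCommGroup F] [NormedSpace ℂ F] [CompleteSpace F] {n : WithTop ℕ∞}
    {T : P → F →L[ℂ] F} (hT : ContDiff ℝ n T) (hu : ∀ x, IsUnit (1 - T x)) (f : F) :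
    ContDiff ℝ n fun x => Ring.inverse (1 - T x) f := by
  have h1 : ContDiff ℝ n fun x => Ring.inverse (1 - T x) := contDiff_iff_contDiffAt.2 fun x => by
    have h := (contDiffAt_ringInverse ℂ (n := n) (hu x).unit).restrict_scalars ℝ
    rw [IsUnit.unit_spec] at h
    exact h.comp x (contDiff_const.sub hT).contDiffAt
  exact ((ContinuousLinearMap.apply ℂ F f).contDiff.restrict_scalars ℝ).comp h1

lemma ContDiff.clm_apply_complex {P E F : Type*} [NormedAddCommGroup P] [NormedSpace ℝ P]
    [NormedAddCommGroup E] [NormedSpace ℂ E] [NormedAddCommGroup F] [NormedSpace ℂ F]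
    {n : WithTop ℕ∞} {T : P → E →L[ℂ] F} {y : P → E} (hT : ContDiff ℝ n T)
    (hy : ContDiff ℝ n y) : ContDiff ℝ n fun x => T x (y x) := by
  have h : ContDiff ℂ n fun p : (E →L[ℂ] F) × E => p.1 p.2 := isBoundedBilinearMap_apply.contDiff
  exact (h.restrict_scalars ℝ).comp (hT.prodMk hy)

lemma ContDiff.clm_comp_complex {P E F G : Type*} [NormedAddCommGroup P] [NormedSpace ℝ P]
    [NormedAddCommGroup E] [NormedSpace ℂ E] [NormedAddCommGroup F] [NormedSpace ℂ F]
    [NormedAddCommGroup G] [NormedSpace ℂ G]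
    {n : WithTop ℕ∞} {T : P → F →L[ℂ] G} {Y : P → E →L[ℂ] F} (hT : ContDiff ℝ n T)
    (hY : ContDiff ℝ n Y) : ContDiff ℝ n fun x => T x ∘L Y x := by
  have h : ContDiff ℂ n fun p : (F →L[ℂ] G) × (E →L[ℂ] F) => p.1 ∘L p.2 :=
    isBoundedBilinearMap_comp.contDiff
  exact (h.restrict_scalars ℝ).comp (hT.prodMk hY)

section SpectralMap

variable {E : Type*} [NormedAddCommGroup E] [InnerProductSpace ℂ E] [FiniteDimensional ℂ E]
  {T : E →ₗ[ℂ] E} (hT : T.IsSymmetric)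

lemma contDiff_spectralMap {P : Type*} [NormedAddCommGroup P] [NormedSpace ℝ P]
    {n : WithTop ℕ∞} {θ : P → ℝ → ℂ} (hθ : ∀ μ, ContDiff ℝ n fun x => θ x μ) :
    ContDiff ℝ n fun x => spectralMap hT (θ x) :=
  ContDiff.sum fun _ _ => (hθ _).smul contDiff_const

lemma hasDerivAt_spectralMap_apply {θ : ℝ → ℝ → ℂ} {t : ℝ} {c : ℂ}
    (hθ : ∀ i, HasDerivAt (fun τ => θ τ (hT.eigenvalues rfl i))
      (c * (hT.eigenvalues rfl i * θ t (hT.eigenvalues rfl i))) t) {y : ℝ → E} {y' : E}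
    (hy : HasDerivAt y y' t) :
    HasDerivAt (fun τ => spectralMap hT (θ τ) (y τ))
      (spectralMap hT (θ t) y' + c • T (spectralMap hT (θ t) (y t))) t := by
  simp_rw [spectralMap_apply hT (θ _)]
  refine (HasDerivAt.fun_sum fun i _ => (hθ i).smul (((innerSL ℂ
    (hT.eigenvectorBasis rfl i)).hasFDerivAt.restrictScalars ℝ |>.comp_hasDerivAt t hy).smul_const
    (hT.eigenvectorBasis rfl i))).congr_deriv ?_
  rw [← spectralMap_ofReal hT, ← spectralMap_apply hT (θ t) (y t), spectralMap_mul,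
    spectralMap_apply, Finset.smul_sum, ← Finset.sum_add_distrib]
  refine Finset.sum_congr rfl fun i _ => ?_
  rw [mul_smul c]
  rfl

end SpectralMap

lemma HankelModel.contDiff_genOp {E : Type*} [NormedAddCommGroup E] [InnerProductSpace ℂ E]
    [CompleteSpace E] {n : WithTop ℕ∞} : ContDiff ℂ n (genOp : (E →L[ℂ] E) → _) :=
  contDiff_const.clm_comp (ContinuousLinearMap.contDiff _)

namespace HankelModel

variable {E : Type*} [NormedAddCommGroup E] [InnerProductSpace ℂ E] [CompleteSpace E]
  [FiniteDimensional ℂ E] (M : HankelModel E)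

/-- The Wiener function generated by a twisted model. -/
def twistSymbol (θ : ℝ → ℂ) : Wiener :=
  gen (M.twistA θ) M.e (M.twistH (fun μ => conj (θ μ)) M.u)

lemma twistSymbol_eq (θ : ℝ → ℂ) (hθ : ∀ μ, conj (θ μ) * θ μ = 1) : M.twistSymbol θ =
    gen (M.twist θ hθ).A (M.twist θ hθ).e (M.twist θ hθ).u := rfl

lemma contDiff_twistSymbol {P : Type*} [NormedAddCommGroup P] [NormedSpace ℝ P]
    {n : WithTop ℕ∞} {θ : P → ℝ → ℂ} (hθ : ∀ x μ, conj (θ x μ) * θ x μ = 1)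
    (hs : ∀ μ, ContDiff ℝ n fun x => θ x μ) : ContDiff ℝ n fun x => M.twistSymbol (θ x) := by
  have hH : ContDiff ℝ n fun x => M.twistH fun μ => conj (θ x μ) :=
    contDiff_spectralMap _ fun μ => Complex.conjCLE.contDiff.comp (hs μ)
  have hA : ContDiff ℝ n fun x => M.twistA (θ x) :=
    hH.clm_comp_complex ((contDiff_spectralMap _ hs).clm_comp_complex contDiff_const)
  have hG : ContDiff ℝ n fun x => gen (M.twistA (θ x)) M.e :=
    ContDiff.ringInverse_one_sub_apply ((contDiff_genOp.restrict_scalars ℝ).comp hA)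
      (fun x => (M.twist (θ x) (hθ x)).isUnit_one_sub_genOp) _
  exact hG.clm_apply_complex (hH.clm_apply_complex contDiff_const)

/-- The frequencies of the Szegő flow. -/
def freqs : Finset ℝ :=
  Finset.univ.image (M.isSymmetric_H_sq.eigenvalues rfl) ∪
    Finset.univ.image (M.isSymmetric_K_sq.eigenvalues rfl)

section Flow

variable {θ : ℝ → ℝ → ℂ} {t : ℝ}

lemma hasDerivAt_twistH_conj
    (hd : ∀ μ ∈ M.freqs, HasDerivAt (fun τ => θ τ μ) (Complex.I * (μ * θ t μ)) t)
    {y : ℝ → E} {y' : E} (hy : HasDerivAt y y' t) :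
    HasDerivAt (fun τ => M.twistH (fun μ => conj (θ τ μ)) (y τ))
      (M.twistH (fun μ => conj (θ t μ)) y' +
        (-Complex.I) • M.H (M.H (M.twistH (fun μ => conj (θ t μ)) (y t)))) t := by
  refine hasDerivAt_spectralMap_apply _ (θ := fun τ μ => conj (θ τ μ)) (fun i => ?_) hy
  refine (hd _ (Finset.mem_union_left _ (Finset.mem_image_of_mem _ (Finset.mem_univ
    i)))).star.congr_deriv ?_
  simp

lemma hasDerivAt_twistK
    (hd : ∀ μ ∈ M.freqs, HasDerivAt (fun τ => θ τ μ) (Complex.I * (μ * θ t μ)) t)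
    {y : ℝ → E} {y' : E} (hy : HasDerivAt y y' t) :
    HasDerivAt (fun τ => M.twistK (θ τ) (y τ))
      (M.twistK (θ t) y' + Complex.I • M.K (M.K (M.twistK (θ t) (y t)))) t :=
  hasDerivAt_spectralMap_apply _ (fun i => hd _ (Finset.mem_union_right _
    (Finset.mem_image_of_mem _ (Finset.mem_univ i)))) hy

lemma hasDerivAt_twistA
    (hd : ∀ μ ∈ M.freqs, HasDerivAt (fun τ => θ τ μ) (Complex.I * (μ * θ t μ)) t)
    (hθ : ∀ μ, conj (θ t μ) * θ t μ = 1) {y : ℝ → E} {y' : E}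
    (hy : HasDerivAt y y' t) :
    HasDerivAt (fun τ => M.twistA (θ τ) (y τ))
      (M.twistA (θ t) y' + (-Complex.I) • ⟪M.twistH (fun μ => conj (θ t μ)) M.u,
        M.twistA (θ t) (y t)⟫_ℂ • M.twistH (fun μ => conj (θ t μ)) M.u) t := by
  have hA : HasDerivAt (fun τ => M.A (y τ)) (M.A y') t :=
    (M.A.hasFDerivAt.restrictScalars ℝ).comp_hasDerivAt t hy
  have hθ' (μ : ℝ) : conj (conj (θ t μ)) * conj (θ t μ) = 1 := by
    rw [Complex.conj_conj, mul_comm, hθ]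
  have hHH (x : E) : M.twistH (fun μ => conj (θ t μ)) (M.H (M.H x)) =
      M.H (M.H (M.twistH (fun μ => conj (θ t μ)) x)) := by
    rw [H_twistH, H_twistH]
    simp_rw [Complex.conj_conj]
  refine (M.hasDerivAt_twistH_conj hd (M.hasDerivAt_twistK hd hA)).congr_deriv ?_
  rw [map_add, map_smul, K_K, map_sub, map_smul, hHH, ← twistA_apply, ← twistA_apply,
    ← inner_spectralMap_spectralMap M.isSymmetric_H_sq hθ' M.u, ← twistH]
  change _ + Complex.I • (_ - ⟪_, M.twistA (θ t) (y t)⟫_ℂ • _) + _ = _ + _ • ⟪_, _⟫_ℂ • _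
  module

lemma hasDerivAt_twistA_pow
    (hd : ∀ μ ∈ M.freqs, HasDerivAt (fun τ => θ τ μ) (Complex.I * (μ * θ t μ)) t)
    (hθ : ∀ μ, conj (θ t μ) * θ t μ = 1) (n : ℕ) :
    HasDerivAt (fun τ => (M.twistA (θ τ) ^ n) (M.twistH (fun μ => conj (θ τ μ)) M.u))
      ((-Complex.I) • ((M.twistA (θ t) ^ n) (M.H (M.H (M.twistH (fun μ => conj (θ t μ)) M.u))) +
        ∑ p ∈ Finset.range n, ⟪M.twistH (fun μ => conj (θ t μ)) M.u,
          (M.twistA (θ t) ^ (n - p)) (M.twistH (fun μ => conj (θ t μ)) M.u)⟫_ℂ •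
          (M.twistA (θ t) ^ p) (M.twistH (fun μ => conj (θ t μ)) M.u))) t := by
  induction n with
  | zero =>
    refine (M.hasDerivAt_twistH_conj hd (hasDerivAt_const t M.u)).congr_deriv ?_
    simp
  | succ n ih =>
    simp_rw [pow_succ' (M.twistA _) n, mul_apply_eq_comp]
    refine (M.hasDerivAt_twistA hd hθ ih).congr_deriv ?_
    rw [Finset.sum_range_succ', map_smul, map_add, map_sum, ← smul_add]
    simp only [map_smul, pow_succ', mul_apply_eq_comp, Nat.add_sub_add_right, Nat.sub_zero,
      pow_zero, one_apply_eq_self, add_assoc]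

lemma hasDerivAt_twistSymbol_apply
    (hd : ∀ μ ∈ M.freqs, HasDerivAt (fun τ => θ τ μ) (Complex.I * (μ * θ t μ)) t)
    (hθ : ∀ τ μ, conj (θ τ μ) * θ τ μ = 1) (n : ℕ) :
    HasDerivAt (fun τ => M.twistSymbol (θ τ) n)
      (-Complex.I * szegoVec (M.twistSymbol (θ t)) n) t := by
  have h1 (τ : ℝ) := (M.twist (θ τ) (hθ τ)).gen_apply n (M.twist (θ τ) (hθ τ)).u
  simp_rw [M.twistSymbol_eq (θ _) (hθ _), h1]
  refine (((innerSL ℂ M.e).hasFDerivAt.restrictScalars ℝ).comp_hasDerivAt t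
    (M.hasDerivAt_twistA_pow hd (hθ t) n)).congr_deriv ?_
  rw [szegoVec_gen, twist_H_H]
  change ⟪M.e, _ • (_ + _)⟫_ℂ = _
  rw [inner_smul_right, inner_add_right, inner_sum]
  simp only [inner_smul_right]
  refine congrArg _ (congrArg _ (Finset.sum_congr rfl fun p _ => mul_comm _ _))

end Flow

end HankelModel

lemma exists_hankelModel {E : Type*} [NormedAddCommGroup E] [InnerProductSpace ℂ E]
    [CompleteSpace E] [FiniteDimensional ℂ E] {A : E →L[ℂ] E} {e u : E}
    (hA : ∀ x y, ⟪A x, A y⟫_ℂ = ⟪x, y⟫_ℂ - ⟪x, e⟫_ℂ * ⟪e, y⟫_ℂ)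
    (he : ∀ x, (∀ n : ℕ, ⟪e, (A ^ n) x⟫_ℂ = 0) → x = 0)
    (hu : ∀ x, (∀ n : ℕ, ⟪x, (A ^ n) u⟫_ℂ = 0) → x = 0) :
    ∃ M : HankelModel E, M.A = A ∧ M.e = e ∧ M.u = u := by
  have hadj (n : ℕ) (x y : E) : ⟪(A.adjoint ^ n) x, y⟫_ℂ = ⟪x, (A ^ n) y⟫_ℂ := by
    rw [← ContinuousLinearMap.adjoint_inner_left, ← ContinuousLinearMap.star_eq_adjoint,
      ← ContinuousLinearMap.star_eq_adjoint, star_pow]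
  have hspan : Submodule.span ℂ (Set.range fun p => (A.adjoint ^ p) e) = ⊤ := by
    rw [← Submodule.orthogonal_eq_bot_iff, Submodule.eq_bot_iff]
    refine fun x hx => he x fun n => ?_
    have hn : (A.adjoint ^ n) e ∈ Submodule.span ℂ (Set.range fun p => (A.adjoint ^ p) e) :=
      Submodule.subset_span ⟨n, rfl⟩
    rw [← hadj]
    exact Submodule.inner_right_of_mem_orthogonal hn hx
  have hex (x : E) : ∃ y, ∀ n : ℕ, ⟪e, (A ^ n) y⟫_ℂ = ⟪x, (A ^ n) u⟫_ℂ := by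
    have hx : x ∈ Submodule.span ℂ (Set.range fun p => (A.adjoint ^ p) e) := hspan ▸ trivial
    induction hx using Submodule.span_induction with
    | mem x hx =>
      obtain ⟨p, rfl⟩ := hx
      refine ⟨(A ^ p) u, fun n => ?_⟩
      rw [hadj, ← mul_apply_eq_comp, ← mul_apply_eq_comp, ← pow_add, ← pow_add, add_comm]
    | zero => exact ⟨0, fun n => by rw [map_zero, inner_zero_left, inner_zero_right]⟩
    | add x y _ _ hx hy =>
      obtain ⟨x', hx⟩ := hx
      obtain ⟨y', hy⟩ := hy
      exact ⟨x' + y', fun n => by rw [map_add, inner_add_left, inner_add_right, hx, hy]⟩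
    | smul c x _ hx =>
      obtain ⟨x', hx⟩ := hx
      exact ⟨conj c • x', fun n => by rw [map_smul, inner_smul_left, inner_smul_right, hx]⟩
  have huniq (y z : E) (h : ∀ n : ℕ, ⟪e, (A ^ n) y⟫_ℂ = ⟪e, (A ^ n) z⟫_ℂ) : y = z :=
    sub_eq_zero.1 (he _ fun n => by rw [map_sub, inner_sub_right, h, sub_self])
  choose H hH using hex
  have hHA (p : ℕ) : H ((A.adjoint ^ p) e) = (A ^ p) u := huniq _ _ fun n => by
    rw [hH, hadj, ← mul_apply_eq_comp, ← mul_apply_eq_comp, ← pow_add, ← pow_add, add_comm]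
  have hadd (x y : E) : H (x + y) = H x + H y := huniq _ _ fun n => by
    rw [map_add, inner_add_right, hH, hH, hH, inner_add_left]
  have hsmul (c : ℂ) (x : E) : H (c • x) = conj c • H x := huniq _ _ fun n => by
    rw [map_smul, inner_smul_right, hH, hH, inner_smul_left]
  refine ⟨{
    A := A
    H := ⟨⟨H, hadd⟩, hsmul⟩
    e := e
    inner_A := hA
    inner_H := fun x y => ?_
    A_H := fun x => huniq _ _ fun n => ?_
    H_injective := fun x y hxy => sub_eq_zero.1 (hu _ fun n => ?_)
    stable := fun z x hz hx => he _ fun n => ?_ }, rfl, rfl, hHA 0⟩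
  · change ⟪H x, y⟫_ℂ = ⟪H y, x⟫_ℂ
    have hy : y ∈ Submodule.span ℂ (Set.range fun p => (A.adjoint ^ p) e) := hspan ▸ trivial
    induction hy using Submodule.span_induction with
    | mem y hy =>
      obtain ⟨p, rfl⟩ := hy
      rw [hHA, ← inner_conj_symm, hadj, hH, inner_conj_symm]
    | zero =>
      have h := hsmul 0 0
      rw [map_zero, zero_smul, zero_smul] at h
      rw [h, inner_zero_left, inner_zero_right]
    | add y z _ _ hy hz => rw [hadd, inner_add_left, inner_add_right, hy, hz]
    | smul c y _ hy => rw [hsmul, inner_smul_left, inner_smul_right, hy, Complex.conj_conj]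
  · change ⟪e, (A ^ n) (A (H x))⟫_ℂ = ⟪e, (A ^ n) (H (A.adjoint x))⟫_ℂ
    rw [hH, ContinuousLinearMap.adjoint_inner_left, ← mul_apply_eq_comp, ← pow_succ, hH,
      pow_succ', mul_apply_eq_comp]
  · change H x = H y at hxy
    rw [inner_sub_left, ← hH, ← hH, hxy, sub_self]
  · have h (n : ℕ) : (A ^ n) x = z ^ n • x := by
      induction n with
      | zero => simp
      | succ n ih => rw [pow_succ', mul_apply_eq_comp, ih, map_smul, hx, smul_smul, pow_succ]
    rw [h, inner_smul_right, (inner_eq_zero_and_adjoint_apply_of_norm_eq_one hA hz hx).1, mul_zero]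

lemma hardyShift_adjoint_apply (f : Hardy) :
    hardyShift (hardyShift.adjoint f) = f - f 0 • hardyBasis 0 := by
  refine lp.ext (funext fun n => ?_)
  rw [lp.coeFn_sub, Pi.sub_apply, lp.coeFn_smul, Pi.smul_apply, hardyBasis_apply]
  cases n with
  | zero => simp
  | succ n => rw [hardyShift_succ, adjoint_hardyShift_apply]; simp

/-- The span of the orbit of `v` under the backward shift. -/
def orbitSpan (v : Hardy) : Submodule ℂ Hardy :=
  Submodule.span ℂ (Set.range fun p => (hardyShift.adjoint ^ p) v)

lemma adjoint_hardyShift_mem_orbitSpan {v x : Hardy} (hx : x ∈ orbitSpan v) :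
    hardyShift.adjoint x ∈ orbitSpan v := by
  have h : orbitSpan v ≤ (orbitSpan v).comap hardyShift.adjoint.toLinearMap := by
    refine Submodule.span_le.2 ?_
    rintro _ ⟨p, rfl⟩
    refine Submodule.subset_span ⟨p + 1, ?_⟩
    change (hardyShift.adjoint ^ (p + 1)) v = _
    rw [pow_succ']
    rfl
  exact h hx

lemma finiteDimensional_orbitSpan (v : Hardy)
    [FiniteDimensional ℂ (LinearMap.range (hankelLM v))] :
    FiniteDimensional ℂ (orbitSpan v) := by
  let c : Hardy →ₗ[ℂ] ℕ → ℂ := LinearMap.pi fun n => (coeffCLM n).toLinearMap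
  have hc : Function.Injective c := fun f g h => lp.ext h
  have h : (orbitSpan v).map c = LinearMap.range (hankelLM v) := by
    rw [range_hankelLM, orbitSpan, Submodule.map_span, ← Set.range_comp]
    congr 2
    funext p n
    change (hardyShift.adjoint ^ p) v n = _
    rw [adjoint_hardyShift_pow_apply]
  have hf : FiniteDimensional ℂ ((orbitSpan v).map c) := by rwa [h]
  exact LinearEquiv.finiteDimensional (Submodule.equivMapOfInjective c hc _).symm

lemma exists_hankelModel_coeffMap (v : Hardy)
    [FiniteDimensional ℂ (LinearMap.range (hankelLM v))] :
    ∃ (E : Submodule ℂ Hardy) (_ : FiniteDimensional ℂ E) (M : HankelModel E),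
      M.coeffMap M.u = v := by
  have := finiteDimensional_orbitSpan v
  let A : orbitSpan v →L[ℂ] orbitSpan v :=
    (hardyShift.adjoint ∘L (orbitSpan v).subtypeL).codRestrict
    (orbitSpan v) fun x => adjoint_hardyShift_mem_orbitSpan x.2
  have hA1 (x : orbitSpan v) : (A x : Hardy) = hardyShift.adjoint x := rfl
  have hA (n : ℕ) (x : orbitSpan v) : ((A ^ n) x : Hardy) = (hardyShift.adjoint ^ n) x := by
    induction n with
    | zero => rfl
    | succ n ih => rw [pow_succ', mul_apply_eq_comp, hA1, ih, pow_succ', mul_apply_eq_comp]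
  let e : orbitSpan v := (orbitSpan v).orthogonalProjectionOnto (hardyBasis 0)
  have he (x : orbitSpan v) : ⟪e, x⟫_ℂ = (x : Hardy) 0 := by
    rw [← inner_hardyBasis_left]
    exact Submodule.inner_orthogonalProjectionOnto_eq_of_mem_right x (hardyBasis 0)
  have heA (n : ℕ) (x : orbitSpan v) : ⟪e, (A ^ n) x⟫_ℂ = (x : Hardy) n := by
    rw [he, hA, adjoint_hardyShift_pow_apply, zero_add]
  let u : orbitSpan v := ⟨v, Submodule.subset_span ⟨0, rfl⟩⟩
  obtain ⟨M, h1, h2, h3⟩ := exists_hankelModel (A := A) (e := e) (u := u)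
    (fun x y => by
      rw [Submodule.coe_inner, hA1, hA1, ContinuousLinearMap.adjoint_inner_left,
        hardyShift_adjoint_apply, inner_sub_right, inner_smul_right, he, ← inner_conj_symm x e, he,
        ← inner_conj_symm (x : Hardy) (hardyBasis 0), inner_hardyBasis_left, mul_comm]
      rfl)
    (fun x hx => Subtype.ext (lp.ext (funext fun n => (heA n x).symm.trans (hx n))))
    (fun x hx => by
      have h : orbitSpan v ≤ LinearMap.ker (innerSL ℂ (x : Hardy)).toLinearMap := by
        refine Submodule.span_le.2 ?_
        rintro _ ⟨n, rfl⟩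
        have := hx n
        rw [Submodule.coe_inner, hA] at this
        exact this
      exact Subtype.ext (inner_self_eq_zero.1 (h x.2)))
  refine ⟨orbitSpan v, this, M, funext fun n => ?_⟩
  rw [HankelModel.coeffMap_apply, h1, h2, h3, heA]

lemma InHs.memℓp_one {u : ℕ → ℂ} (h : InHs 1 u) : Memℓp u 1 := by
  have h1 : Summable fun k : ℕ => 1 / ((k + 1 : ℕ) : ℝ) ^ 2 :=
    (summable_nat_add_iff 1).2 (Real.summable_one_div_nat_pow.2 one_lt_two)
  refine memℓp_gen ?_
  simp only [ENNReal.toReal_one, Real.rpow_one]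
  refine Summable.of_nonneg_of_le (fun k => norm_nonneg _) (fun k => ?_) (Summable.add h h1)
  have h2 : (0 : ℝ) < 1 + (k : ℝ) ^ 2 := by positivity
  have h3 : 1 / (2 * (1 + (k : ℝ) ^ 2)) ≤ 1 / ((k + 1 : ℕ) : ℝ) ^ 2 := by
    push_cast
    gcongr
    nlinarith [sq_nonneg ((k : ℝ) - 1)]
  refine le_trans ?_ (add_le_add_right h3 _)
  rw [Real.rpow_one, add_div' _ _ _ (by positivity), le_div_iff₀ (by positivity)]
  nlinarith [sq_nonneg ((1 + (k : ℝ) ^ 2) * ‖u k‖ - 1), norm_nonneg (u k)]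

lemma hasDerivAt_of_coeff {f : ℝ → Hardy} {w : Hardy} {t : ℝ} (hf : DifferentiableAt ℝ f t)
    (h : ∀ n, HasDerivAt (fun τ => f τ n) (w n) t) : HasDerivAt f w t := by
  refine hf.hasDerivAt.congr_deriv (lp.ext (funext fun n => ?_))
  exact (((coeffCLM n).hasFDerivAt.restrictScalars ℝ).comp_hasDerivAt t hf.hasDerivAt).unique (h n)

lemma isWienerSolution_of_coeff {a : ℝ → Wiener} (ha : ContDiff ℝ 2 fun t => toHardy (a t))
    (h : ∀ t n, HasDerivAt (fun τ => a τ n) (-Complex.I * szegoVec (a t) n) t) :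
    IsWienerSolution a where
  contDiff := ha
  hasDerivAt t := hasDerivAt_of_coeff (ha.differentiable two_ne_zero t) fun n => by
    simp_rw [toHardy_apply]
    exact h t n

lemma conj_exp_I_mul_self (r : ℝ) :
    conj (Complex.exp (Complex.I * r)) * Complex.exp (Complex.I * r) = 1 := by
  rw [← Complex.exp_conj, ← Complex.exp_add]
  simp

lemma HankelModel.twistSymbol_one {E : Type*} [NormedAddCommGroup E] [InnerProductSpace ℂ E]
    [CompleteSpace E] [FiniteDimensional ℂ E] (M : HankelModel E) :
    M.twistSymbol (fun _ => 1) = gen M.A M.e M.u := by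
  have hA : M.twistA (fun _ => 1) = M.A := ContinuousLinearMap.ext fun x => by
    rw [twistA_apply, twistK, spectralMap_one, map_one, twistH, spectralMap_one]
  rw [twistSymbol, hA, map_one, twistH, spectralMap_one]

lemma HankelModel.inV_twistSymbol {E : Type*} [NormedAddCommGroup E] [InnerProductSpace ℂ E]
    [CompleteSpace E] [FiniteDimensional ℂ E] (M : HankelModel E) {d : ℕ}
    (h : InV d (M.coeffMap M.u)) {θ : ℝ → ℂ} (hθ : ∀ μ, conj (θ μ) * θ μ = 1) :
    InV d (M.twistSymbol θ) := by
  rw [twistSymbol_eq _ _ hθ, ← coeffMap_eq_gen]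
  refine (M.twist θ hθ).inV_coeffMap_u (M.hankelRank_coeffMap_u.symm.trans h.2.2.1) ?_
  exact (M.finrank_range_twistA θ hθ).trans (M.hankelRank_coeffMap_u_succ.symm.trans h.2.2.2)

lemma exists_torus_phases (Λ : Finset ℝ) :
    ∃ n : ℕ, 0 < n ∧ ∃ (ω : Fin n → ℝ) (θ : (Fin n → ℝ) → ℝ → ℂ),
      (∀ x μ, conj (θ x μ) * θ x μ = 1) ∧
      (∀ (m : WithTop ℕ∞) (μ), ContDiff ℝ m fun x => θ x μ) ∧
      (∀ x k, θ (Function.update x k (x k + 2 * Real.pi)) = θ x) ∧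
      (∀ μ, θ 0 μ = 1) ∧
      ∀ μ ∈ Λ, ∀ t : ℝ, HasDerivAt (fun τ : ℝ => θ (fun k => ω k * τ) μ)
        (Complex.I * (μ * θ (fun k => ω k * t) μ)) t := by
  have h0 : (0 : ℝ) ∈ insert 0 Λ := Finset.mem_insert_self _ _
  generalize hΛ' : insert 0 Λ = Λ' at h0
  obtain ⟨idx, hidx⟩ : ∃ idx : ℝ → Fin Λ'.card, ∀ μ ∈ Λ', (Λ'.equivFin.symm (idx μ) : ℝ) = μ := by
    refine ⟨fun μ => if h : μ ∈ Λ' then Λ'.equivFin ⟨μ, h⟩ else Λ'.equivFin ⟨0, h0⟩,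
      fun μ hμ => ?_⟩
    simp [hμ]
  refine ⟨Λ'.card, Finset.card_pos.2 ⟨0, h0⟩, fun k => Λ'.equivFin.symm k,
    fun x μ => Complex.exp (Complex.I * x (idx μ)), fun x μ => conj_exp_I_mul_self _,
    fun m μ => ?_, fun x k => funext fun μ => ?_, fun μ => by simp, fun μ hμ t => ?_⟩
  · exact (contDiff_const.mul
      (Complex.ofRealCLM.contDiff.comp (contDiff_apply ℝ ℝ (idx μ)))).cexp
  · by_cases hk : idx μ = k
    · simp only [hk, Function.update_self]
      push_cast
      rw [mul_add, Complex.exp_add, mul_comm Complex.I (2 * _), Complex.exp_two_pi_mul_I, mul_one]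
    · simp only [Function.update_of_ne hk]
  · simp only [hidx μ (hΛ' ▸ Finset.mem_insert_of_mem hμ)]
    have h1 : HasDerivAt (fun τ : ℝ => Complex.I * ((μ * τ : ℝ) : ℂ)) (Complex.I * μ) t := by
      simpa using (((hasDerivAt_id t).const_mul μ).ofReal_comp).const_mul Complex.I
    exact h1.cexp.congr_deriv (by ring)

/-- **Quasiperiodicity on the finite rank manifolds `𝒱(d)`** (Theorem 1.2). -/
theorem statement1 (d : ℕ) (hd : 0 < d) (u : ℝ → Hardy)
    (hsol : ∀ s : ℝ, 1 / 2 < s → IsSzegoSolution s u)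
    (h0 : InV d (coeffs (u 0))) :
    (∀ t : ℝ, InV d (coeffs (u t))) ∧
      ∃ n : ℕ, 0 < n ∧ ∃ (ω : Fin n → ℝ) (Φ : (Fin n → ℝ) → Hardy),
        ContDiff ℝ (⊤ : ℕ∞) Φ ∧
        (∀ (x : Fin n → ℝ) (k : Fin n), Φ (Function.update x k (x k + 2 * Real.pi)) = Φ x) ∧
        (∀ x : Fin n → ℝ, InV d (coeffs (Φ x))) ∧
        ∀ t : ℝ, u t = Φ fun k => ω k * t := by
  have : FiniteDimensional ℂ (LinearMap.range (hankelLM (u 0))) := h0.2.1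
  obtain ⟨E, hE, M, hM⟩ := exists_hankelModel_coeffMap (u 0)
  have hV : InV d (M.coeffMap M.u) := hM ▸ h0
  choose! a ha using fun t => (⟨⟨coeffs (u t), ((hsol 1 (by norm_num)).1 t).memℓp_one⟩, rfl⟩ :
    ∃ a : Wiener, (a : ℕ → ℂ) = coeffs (u t))
  have hau (t : ℝ) : toHardy (a t) = u t := lp.ext (by rw [coe_toHardy, ha]; rfl)
  have hsa : IsWienerSolution a := by
    refine isWienerSolution_of_coeff ?_ fun t n => ?_
    · simp_rw [hau]
      exact (hsol 1 (by norm_num)).2.1.of_le (WithTop.coe_le_coe.2 (le_top : (2 : ℕ∞) ≤ ⊤))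
    · simp_rw [szegoVec_apply, ha]
      exact (hsol 1 (by norm_num)).2.2 t n
  obtain ⟨n, hn, ω, θ, hθ, hs, hp, hθ0, hd⟩ := exists_torus_phases M.freqs
  have hsmooth (m : WithTop ℕ∞) : ContDiff ℝ m fun x => M.twistSymbol (θ x) :=
    M.contDiff_twistSymbol hθ (hs m)
  have hsmooth_v (m : WithTop ℕ∞) :
      ContDiff ℝ m fun t : ℝ => M.twistSymbol (θ fun k => ω k * t) :=
    (hsmooth m).comp (contDiff_pi.2 fun k => contDiff_const.mul contDiff_id)
  have hv : IsWienerSolution fun t => M.twistSymbol (θ fun k => ω k * t) :=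
    isWienerSolution_of_coeff ((toHardy.contDiff.restrict_scalars ℝ).comp (hsmooth_v 2))
      fun t m => M.hasDerivAt_twistSymbol_apply (θ := fun τ => θ fun k => ω k * τ)
        (fun μ hμ => hd μ hμ t) (fun τ => hθ _) m
  have hu (t : ℝ) : u t = toHardy (M.twistSymbol (θ fun k => ω k * t)) := by
    rw [← hau t]
    refine hsa.toHardy_eq hv (hsmooth_v 1) ?_ t
    have h1 : (θ fun k => ω k * 0) = fun _ => 1 := by
      simp_rw [mul_zero]
      exact funext hθ0
    rw [hau, h1, M.twistSymbol_one]
    refine lp.ext ?_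
    rw [coe_toHardy, ← M.coeffMap_eq_gen, hM]
  have hΦ (x) : InV d (coeffs (toHardy (M.twistSymbol (θ x)))) := by
    change InV d (toHardy (M.twistSymbol (θ x)) : ℕ → ℂ)
    rw [coe_toHardy]
    exact M.inV_twistSymbol hV (hθ x)
  exact ⟨fun t => hu t ▸ hΦ _, n, hn, ω, fun x => toHardy (M.twistSymbol (θ x)),
    (toHardy.contDiff.restrict_scalars ℝ).comp (hsmooth _),
    fun x k => congrArg (fun η => toHardy (M.twistSymbol η)) (hp x k), hΦ, hu⟩

end
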